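/- arXiv:0911.0668 — 2 statements merged into one kernel-verified Lean document; each statement's English description precedes it below -/
import Mathlib

section
/- Let v : ℂ → ℂⁿ be a C¹ map with compact support contained in D and let τ > 0. Then ∫_D ‖∂v/∂z̄(z)‖² e^{τφ(z)} dA = ∫_D ‖∂v/∂z(z) + (τ/2)·φ'(z)·v(z)‖² e^{τφ(z)} dA + (τ/4) ∫_D ‖v(z)‖² e^{τφ(z)} dA, where φ'(x+iy) = 1 + x and dA is Lebesgue measure on ℂ. -/
open Complex MeasureTheory Metric Filter Topology

/-- The Wirtinger derivative `∂u/∂z̄ = (1/2)(∂u/∂x + i • ∂u/∂y)`. -/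
noncomputable def dbar {E : Type*} [NormedAddCommGroup E] [NormedSpace ℂ E]
    (u : ℂ → E) (z : ℂ) : E :=
  (2⁻¹ : ℝ) • (fderiv ℝ u z 1 + Complex.I • fderiv ℝ u z Complex.I)

/-- The Wirtinger derivative `∂u/∂z = (1/2)(∂u/∂x - i • ∂u/∂y)`. -/
noncomputable def dz {E : Type*} [NormedAddCommGroup E] [NormedSpace ℂ E]
    (u : ℂ → E) (z : ℂ) : E :=
  (2⁻¹ : ℝ) • (fderiv ℝ u z 1 - Complex.I • fderiv ℝ u z Complex.I)

/-- The weight `φ(x+iy) = x + x²/2`. -/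
noncomputable def phi (z : ℂ) : ℝ := z.re + z.re ^ 2 / 2

theorem aux_sub {μ : Measure ℂ} {f g : ℂ → ℝ} (hf : Integrable f μ) (hg : Integrable g μ) :
    Integrable (fun z => f z - g z) μ := hf.sub hg

theorem aux_ibp {h g : ℂ → ℝ} (hh : ContDiff ℝ 1 h) (hg : ContDiff ℝ 1 g)
    (ch : HasCompactSupport h) (e : ℂ) :
    ∫ x, g x * fderiv ℝ h x e = - ∫ x, fderiv ℝ g x e * h x := by
  have c1 := hh.continuous
  have c2 := hg.continuous
  have c3 : Continuous fun x => fderiv ℝ h x e :=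
    (hh.continuous_fderiv one_ne_zero).clm_apply continuous_const
  have c4 : Continuous fun x => fderiv ℝ g x e :=
    (hg.continuous_fderiv one_ne_zero).clm_apply continuous_const
  apply integral_mul_fderiv_eq_neg_fderiv_mul_of_integrable
  · exact (c4.mul c1).integrable_of_hasCompactSupport ch.mul_left
  · exact (c2.mul c3).integrable_of_hasCompactSupport (ch.fderiv_apply ℝ e).mul_left
  · exact (c2.mul c1).integrable_of_hasCompactSupport ch.mul_left
  · exact fun x _ => hg.differentiable one_ne_zero x
  · exact fun x _ => hh.differentiable one_ne_zero x

theorem aux_jac {h g : ℂ → ℝ} (hh : ContDiff ℝ 1 h) (hg : ContDiff ℝ 1 g)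
    (ch : HasCompactSupport h) (cg : HasCompactSupport g) (e f : ℂ) :
    ∫ x, fderiv ℝ g x f * fderiv ℝ h x e = ∫ x, fderiv ℝ h x f * fderiv ℝ g x e := by
  obtain ⟨C, hC⟩ := ContDiff.lipschitzWith_of_hasCompactSupport ch hh one_ne_zero
  obtain ⟨D, hD⟩ := ContDiff.lipschitzWith_of_hasCompactSupport cg hg one_ne_zero
  have c1 := hh.continuous
  have c2 := hg.continuous
  have c3 : Continuous fun x => fderiv ℝ h x e :=
    (hh.continuous_fderiv one_ne_zero).clm_apply continuous_const
  have c4 : Continuous fun x => fderiv ℝ g x e :=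
    (hg.continuous_fderiv one_ne_zero).clm_apply continuous_const
  have i3 : Integrable fun x => fderiv ℝ h x e :=
    c3.integrable_of_hasCompactSupport (ch.fderiv_apply ℝ e)
  have i4 : Integrable fun x => fderiv ℝ g x e :=
    c4.integrable_of_hasCompactSupport (cg.fderiv_apply ℝ e)
  have A := LipschitzWith.integral_inv_smul_sub_mul_tendsto_integral_lineDeriv_mul
    (μ := volume) hD i3 f
  have B := (LipschitzWith.integral_inv_smul_sub_mul_tendsto_integral_lineDeriv_mul
    (μ := volume) hC i4 (-f)).neg
  have key : ∀ t : ℝ, ∫ x, (t⁻¹ • (g (x + t • f) - g x)) * fderiv ℝ h x e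
      = - ∫ x, (t⁻¹ • (h (x + t • (-f)) - h x)) * fderiv ℝ g x e := by
    intro t
    have S : ∫ x, (g (x + t • f) - g x) * fderiv ℝ h x e
      = - ∫ x, (h (x + t • (-f)) - h x) * fderiv ℝ g x e := by
      simp_rw [sub_mul]
      have I1 : Integrable fun x => g (x + t • f) * fderiv ℝ h x e :=
        Continuous.integrable_of_hasCompactSupport (by fun_prop) (ch.fderiv_apply ℝ e).mul_left
      have I2 : Integrable fun x => g x * fderiv ℝ h x e :=
        Continuous.integrable_of_hasCompactSupport (by fun_prop) (ch.fderiv_apply ℝ e).mul_left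
      have I3 : Integrable fun x => h (x + t • (-f)) * fderiv ℝ g x e :=
        Continuous.integrable_of_hasCompactSupport (by fun_prop) (cg.fderiv_apply ℝ e).mul_left
      have I4 : Integrable fun x => h x * fderiv ℝ g x e :=
        Continuous.integrable_of_hasCompactSupport (by fun_prop) (cg.fderiv_apply ℝ e).mul_left
      rw [integral_sub I1 I2, integral_sub I3 I4, aux_ibp hh hg ch e,
        aux_ibp (g := fun x => g (x + t • f)) hh (by fun_prop) ch e]
      have S3 : ∫ x, fderiv ℝ (fun x => g (x + t • f)) x e * h x
          = ∫ x, h (x + t • (-f)) * fderiv ℝ g x e := by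
        rw [← integral_add_right_eq_self _ (t • (-f))]
        simp [fderiv_comp_add_right, mul_comm]
      rw [S3]
      simp_rw [mul_comm (h _)]
      ring
    simp only [smul_eq_mul, mul_assoc, integral_const_mul, S]
    ring
  simp only [key] at A
  have := tendsto_nhds_unique A B
  simp_rw [(hh.differentiable one_ne_zero _).lineDeriv_eq_fderiv,
    (hg.differentiable one_ne_zero _).lineDeriv_eq_fderiv] at this
  rw [this, ← integral_neg]
  simp

noncomputable def auxT (τ : ℝ) (p q : ℂ → ℝ) (z : ℂ) : ℝ :=
  ((fderiv ℝ p z 1 - fderiv ℝ q z I) ^ 2 + (fderiv ℝ q z 1 + fderiv ℝ p z I) ^ 2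
    - (fderiv ℝ p z 1 + fderiv ℝ q z I + τ * (1 + z.re) * p z) ^ 2
    - (fderiv ℝ q z 1 - fderiv ℝ p z I + τ * (1 + z.re) * q z) ^ 2
    - τ * ((p z) ^ 2 + (q z) ^ 2)) * Real.exp (τ * phi z)

theorem aux_phi (τ : ℝ) (z : ℂ) : HasFDerivAt (fun z : ℂ => Real.exp (τ * phi z))
    (((τ * (1 + z.re)) * Real.exp (τ * phi z)) • Complex.reCLM) z := by
  have h1 : HasFDerivAt (fun z : ℂ => z.re) Complex.reCLM z := Complex.reCLM.hasFDerivAt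
  have h2 : HasDerivAt (fun x : ℝ => Real.exp (τ * (x + x ^ 2 / 2)))
      ((τ * (1 + z.re)) * Real.exp (τ * phi z)) z.re := by
    have := ((((hasDerivAt_id z.re).add (((hasDerivAt_id z.re).pow 2).div_const 2))).const_mul τ).exp
    convert! this using 1
    simp [phi]
    ring
  exact h2.comp_hasFDerivAt z h1

theorem aux_phi_cd (τ : ℝ) : ContDiff ℝ 1 (fun z : ℂ => Real.exp (τ * phi z)) := by
  have : ContDiff ℝ 1 (fun z : ℂ => z.re) := Complex.reCLM.contDiff
  unfold phi
  fun_prop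

theorem aux_int (τ : ℝ) {p q : ℂ → ℝ} (hp : ContDiff ℝ 1 p) (hq : ContDiff ℝ 1 q)
    (cp : HasCompactSupport p) (cq : HasCompactSupport q) :
    ∫ z, auxT τ p q z = 0 := by
  have hre : ContDiff ℝ 1 (fun z : ℂ => z.re) := Complex.reCLM.contDiff
  have hw := aux_phi_cd τ
  set w := fun z : ℂ => Real.exp (τ * phi z) with hwdef
  have cont : ∀ {k : ℂ → ℝ} (_ : ContDiff ℝ 1 k) (e : ℂ), Continuous fun x => fderiv ℝ k x e :=
    fun hk e => (hk.continuous_fderiv one_ne_zero).clm_apply continuous_const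
  have D1 : ∀ {k : ℂ → ℝ} (_ : ContDiff ℝ 1 k) (z e : ℂ), fderiv ℝ (fun z => w z * k z) z e
      = w z * fderiv ℝ k z e + k z * (τ * (1 + z.re) * w z * e.re) := by
    intro k hk z e
    rw [((aux_phi τ z).fun_mul (hk.differentiable one_ne_zero z).hasFDerivAt).fderiv]
    simp [hwdef]
  have hP : ContDiff ℝ 1 (fun z => w z * p z) := hw.mul hp
  have hQ : ContDiff ℝ 1 (fun z => w z * q z) := hw.mul hq
  have cP : HasCompactSupport (fun z => w z * p z) := cp.mul_left
  have cQ : HasCompactSupport (fun z => w z * q z) := cq.mul_left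
  have J1 := aux_jac hP hq cP cq 1 I
  have J2 := aux_jac hQ hp cQ cp 1 I
  have IB : ∀ {k : ℂ → ℝ} (_ : ContDiff ℝ 1 k) (_ : HasCompactSupport k),
      ∫ z, (τ * k z ^ 2 + (τ * (1 + z.re)) ^ 2 * k z ^ 2
        + 2 * (τ * (1 + z.re)) * k z * fderiv ℝ k z 1) * w z = 0 := by
    intro k hk ck
    have hs : ContDiff ℝ 1 (fun z : ℂ => w z * (τ * (1 + z.re) * k z ^ 2)) := by fun_prop
    have h0 := aux_ibp (g := fun _ => 1) hs contDiff_const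
      (HasCompactSupport.mul_left (HasCompactSupport.mul_left (by
        simp_rw [pow_two]; exact ck.mul_left))) 1
    simp only [one_mul, fderiv_fun_const, Pi.zero_apply, _root_.zero_apply, zero_mul,
      integral_zero, neg_zero] at h0
    rw [← h0]
    congr 1
    ext z
    have hk' := (hk.differentiable one_ne_zero z).hasFDerivAt
    have hr' : HasFDerivAt (fun z : ℂ => z.re) Complex.reCLM z := Complex.reCLM.hasFDerivAt
    rw [D1 (by fun_prop)]
    rw [(((hr'.const_add 1).const_mul τ).fun_mul (hk'.pow 2)).fderiv]
    simp
    ring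
  have K1 := IB hp cp
  have K2 := IB hq cq
  have II : ∀ {a b : ℂ → ℝ}, ContDiff ℝ 1 a → ContDiff ℝ 1 b → HasCompactSupport a → ∀ e f,
      Integrable fun x => fderiv ℝ a x e * fderiv ℝ b x f := fun ha hb ca e f =>
    ((cont ha e).mul (cont hb f)).integrable_of_hasCompactSupport (ca.fderiv_apply ℝ e).mul_right
  have IK : ∀ {k : ℂ → ℝ} (_ : ContDiff ℝ 1 k) (_ : HasCompactSupport k),
      Integrable fun z => (τ * k z ^ 2 + (τ * (1 + z.re)) ^ 2 * k z ^ 2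
        + 2 * (τ * (1 + z.re)) * k z * fderiv ℝ k z 1) * w z := by
    intro k hk ck
    have := cont hk 1
    have := hk.continuous
    have := hre.continuous
    have := hw.continuous
    apply Continuous.integrable_of_hasCompactSupport (by fun_prop)
    refine ck.mono ?_
    intro z hz hz'
    apply hz
    simp [hz']
  have E : ∀ z, auxT τ p q z =
      2 * (fderiv ℝ (fun z => w z * p z) z I * fderiv ℝ q z 1
        - fderiv ℝ q z I * fderiv ℝ (fun z => w z * p z) z 1)
      + 2 * (fderiv ℝ p z I * fderiv ℝ (fun z => w z * q z) z 1
        - fderiv ℝ (fun z => w z * q z) z I * fderiv ℝ p z 1)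
      - (τ * p z ^ 2 + (τ * (1 + z.re)) ^ 2 * p z ^ 2
        + 2 * (τ * (1 + z.re)) * p z * fderiv ℝ p z 1) * w z
      - (τ * q z ^ 2 + (τ * (1 + z.re)) ^ 2 * q z ^ 2
        + 2 * (τ * (1 + z.re)) * q z * fderiv ℝ q z 1) * w z := by
    intro z
    rw [D1 hp, D1 hp, D1 hq, D1 hq, auxT]
    simp [hwdef]
    ring
  simp_rw [E]
  have i1 := II hP hq cP I 1
  have i2 := II hq hP cq I 1
  have i3 := II hp hQ cp I 1
  have i4 := II hQ hp cQ I 1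
  have i12 := (i1.sub i2).const_mul 2
  have i34 := (i3.sub i4).const_mul 2
  simp only [Pi.sub_apply] at i12 i34
  rw [integral_sub (aux_sub (i12.fun_add i34) (IK hp cp)) (IK hq cq),
    integral_sub (i12.fun_add i34) (IK hp cp), integral_add i12 i34, integral_const_mul,
    integral_const_mul, integral_sub i1 i2, integral_sub i3 i4, J1, J2, K1, K2]
  ring

theorem aux_pt (n : ℕ) (v : ℂ → EuclideanSpace ℂ (Fin n))
    (hv : ContDiff ℝ 1 v) (τ : ℝ) (z : ℂ) :
    ‖dbar v z‖ ^ 2 * Real.exp (τ * phi z)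
      - ‖dz v z + ((τ / 2) * (1 + z.re)) • v z‖ ^ 2 * Real.exp (τ * phi z)
      - (τ / 4) * (‖v z‖ ^ 2 * Real.exp (τ * phi z))
    = ∑ k, (1 / 4) * auxT τ (fun z => (v z k).re) (fun z => (v z k).im) z := by
  have hd := (hv.differentiable one_ne_zero z).hasFDerivAt
  have hk : ∀ k, HasFDerivAt (fun z => v z k)
      (((EuclideanSpace.proj k : EuclideanSpace ℂ (Fin n) →L[ℂ] ℂ).restrictScalars ℝ).comp
        (fderiv ℝ v z)) z := fun k =>
    ((EuclideanSpace.proj k : EuclideanSpace ℂ (Fin n) →L[ℂ] ℂ).restrictScalars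
      ℝ).hasFDerivAt.comp z hd
  have hr : ∀ k e, fderiv ℝ (fun z => (v z k).re) z e = (fderiv ℝ v z e k).re := by
    intro k e
    rw [(Complex.reCLM.hasFDerivAt.comp z (hk k)).fderiv (f := fun z => (v z k).re)]
    simp
  have hi : ∀ k e, fderiv ℝ (fun z => (v z k).im) z e = (fderiv ℝ v z e k).im := by
    intro k e
    rw [(Complex.imCLM.hasFDerivAt.comp z (hk k)).fderiv (f := fun z => (v z k).im)]
    simp
  rw [EuclideanSpace.norm_sq_eq, EuclideanSpace.norm_sq_eq, EuclideanSpace.norm_sq_eq,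
    Finset.sum_mul, Finset.sum_mul, Finset.sum_mul, Finset.mul_sum, ← Finset.sum_sub_distrib,
    ← Finset.sum_sub_distrib]
  refine Finset.sum_congr rfl fun k _ => ?_
  simp only [auxT, hr, hi, dbar, dz, Complex.sq_norm, Complex.normSq_apply]
  simp
  ring

/-- for `v : ℂ → ℂⁿ` of class `C¹`, compactly supported in the unit
disc, and `τ > 0`,
`∫ ‖∂v/∂z̄‖² e^{τφ} = ∫ ‖∂v/∂z + (τ/2)·φ'·v‖² e^{τφ} + (τ/4) ∫ ‖v‖² e^{τφ}`,
where `φ'(x+iy) = 1 + x`. -/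
theorem carleman_identity (n : ℕ) (v : ℂ → EuclideanSpace ℂ (Fin n))
    (hv : ContDiff ℝ 1 v) (hsupp : HasCompactSupport v)
    (hsub : tsupport v ⊆ ball (0 : ℂ) 1) (τ : ℝ) (hτ : 0 < τ) :
    ∫ z in ball (0 : ℂ) 1, ‖dbar v z‖ ^ 2 * Real.exp (τ * phi z)
      = (∫ z in ball (0 : ℂ) 1,
          ‖dz v z + ((τ / 2) * (1 + z.re)) • v z‖ ^ 2 * Real.exp (τ * phi z))
        + (τ / 4) * ∫ z in ball (0 : ℂ) 1, ‖v z‖ ^ 2 * Real.exp (τ * phi z) := by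
  have hw := (aux_phi_cd τ).continuous
  have hc := hv.continuous
  have hd : ∀ e, Continuous fun z => fderiv ℝ v z e := fun e =>
    (hv.continuous_fderiv one_ne_zero).clm_apply continuous_const
  have h1 := hd 1
  have h2 := hd I
  have hre := Complex.continuous_re
  have hI : ∀ {F : ℂ → ℝ}, Continuous F → IntegrableOn F (ball (0 : ℂ) 1) := fun hF =>
    (hF.continuousOn.integrableOn_compact (isCompact_closedBall (0 : ℂ) 1)).mono_set
      ball_subset_closedBall
  have hF := hI (F := fun z => ‖dbar v z‖ ^ 2 * Real.exp (τ * phi z)) (by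
    unfold dbar; fun_prop)
  have hG := hI (F := fun z => ‖dz v z + ((τ / 2) * (1 + z.re)) • v z‖ ^ 2
    * Real.exp (τ * phi z)) (by unfold dz; fun_prop)
  have hH := (hI (F := fun z => ‖v z‖ ^ 2 * Real.exp (τ * phi z)) (by fun_prop)).const_mul (τ / 4)
  rw [← integral_const_mul, ← sub_eq_zero, ← sub_sub, ← integral_sub hF hG,
    ← integral_sub (aux_sub hF hG) hH]
  simp_rw [aux_pt n v hv τ]
  have hproj : ∀ k, ContDiff ℝ 1 (fun z => v z k) := fun k =>
    ((EuclideanSpace.proj k : EuclideanSpace ℂ (Fin n) →L[ℂ] ℂ).restrictScalars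
      ℝ).contDiff.comp hv
  have hr : ∀ k, ContDiff ℝ 1 (fun z => (v z k).re) := fun k =>
    Complex.reCLM.contDiff.comp (hproj k)
  have hi : ∀ k, ContDiff ℝ 1 (fun z => (v z k).im) := fun k =>
    Complex.imCLM.contDiff.comp (hproj k)
  have sr : ∀ k, Function.support (fun z => (v z k).re) ⊆ Function.support v := by
    intro k z hz hz'
    apply hz
    simp [hz']
  have si : ∀ k, Function.support (fun z => (v z k).im) ⊆ Function.support v := by
    intro k z hz hz'
    apply hz
    simp [hz']
  have cont : ∀ {k : ℂ → ℝ} (_ : ContDiff ℝ 1 k) (e : ℂ), Continuous fun x => fderiv ℝ k x e :=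
    fun hk e => (hk.continuous_fderiv one_ne_zero).clm_apply continuous_const
  rw [integral_finsetSum]
  · refine Finset.sum_eq_zero fun k _ => ?_
    rw [integral_const_mul, setIntegral_eq_integral_of_forall_compl_eq_zero,
      aux_int τ (hr k) (hi k) (hsupp.mono (sr k)) (hsupp.mono (si k)), mul_zero]
    intro z hz
    have hz' : z ∉ tsupport v := fun h => hz (hsub h)
    have zr : z ∉ tsupport (fun z => (v z k).re) := fun h => hz' (closure_mono (sr k) h)
    have zi : z ∉ tsupport (fun z => (v z k).im) := fun h => hz' (closure_mono (si k) h)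
    have e1 : fderiv ℝ (fun z => (v z k).re) z = 0 := by
      by_contra h
      exact zr (support_fderiv_subset ℝ h)
    have e2 : fderiv ℝ (fun z => (v z k).im) z = 0 := by
      by_contra h
      exact zi (support_fderiv_subset ℝ h)
    simp [auxT, e1, e2, image_eq_zero_of_notMem_tsupport hz']
  · intro k _
    apply Integrable.const_mul
    apply hI
    have a1 := cont (hr k) 1
    have a2 := cont (hr k) I
    have a3 := cont (hi k) 1
    have a4 := cont (hi k) I
    have a5 := (hr k).continuous
    have a6 := (hi k).continuous
    unfold auxT
    fun_prop
end

section
/- Let u : D → ℂ be a C¹ scalar-valued function satisfying |∂u/∂z̄(z)| ≤ a·|∂u/∂z(z)| for all z ∈ D, where 0 ≤ a < 1 is a constant. If the zero set {z ∈ D : u(z) = 0} has an accumulation point in D, then u ≡ 0 on D. -/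
open Complex MeasureTheory Metric Filter Topology

/-- `p` is `C¹` on the plane with partial derivatives `px`, `py`. -/
structure C1 (p px py : ℝ → ℝ → ℝ) : Prop where
  dx : ∀ x y, HasDerivAt (fun t => p t y) (px x y) x
  dy : ∀ x y, HasDerivAt (fun t => p x t) (py x y) y
  c : Continuous (fun z : ℝ × ℝ => p z.1 z.2)
  cx : Continuous (fun z : ℝ × ℝ => px z.1 z.2)
  cy : Continuous (fun z : ℝ × ℝ => py z.1 z.2)

theorem cont2 {f : ℝ → ℝ → ℝ} (h : Continuous (fun z : ℝ × ℝ => f z.1 z.2)) {α : Type*}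
    [TopologicalSpace α] {e1 e2 : α → ℝ} (h1 : Continuous e1) (h2 : Continuous e2) :
    Continuous fun w => f (e1 w) (e2 w) :=
  h.comp (h1.prodMk h2)

theorem contInt {X : Type*} [TopologicalSpace X] {f : X → ℝ → ℝ}
    (h : Continuous (fun w : X × ℝ => f w.1 w.2)) (a b : ℝ) :
    Continuous fun x => ∫ t in a..b, f x t :=
  intervalIntegral.continuous_parametric_intervalIntegral_of_continuous' h a b

theorem swapInt {f : ℝ → ℝ → ℝ} (h : Continuous (fun z : ℝ × ℝ => f z.1 z.2)) (a b c d : ℝ) :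
    ∫ x in a..b, ∫ y in c..d, f x y = ∫ y in c..d, ∫ x in a..b, f x y := by
  apply MeasureTheory.intervalIntegral_intervalIntegral_swap
  have h1 : IsCompact (Set.uIcc a b ×ˢ Set.uIcc c d) := isCompact_uIcc.prod isCompact_uIcc
  have h2 : IntegrableOn (Function.uncurry f) (Set.uIcc a b ×ˢ Set.uIcc c d)
      (volume.prod volume) := by
    have := h.continuousOn.integrableOn_compact (μ := volume.prod volume) h1
    exact this
  exact h2.mono_set (Set.prod_mono Set.uIoc_subset_uIcc Set.uIoc_subset_uIcc)

theorem green_h {p px py q qx qy : ℝ → ℝ → ℝ} (hp : C1 p px py) (hq : C1 q qx qy) (a b c d : ℝ)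
    (h : ℝ) (hh : h ≠ 0) :
    ∫ x in a..b, ∫ y in c..d, (px x y * (∫ s in (0:ℝ)..1, qy (x + h * s) y)
      - py x y * (∫ s in (0:ℝ)..1, qx (x + h * s) y)) =
    (∫ y in c..d, p b y * (∫ s in (0:ℝ)..1, qy (b + h * s) y))
      - (∫ y in c..d, p a y * (∫ s in (0:ℝ)..1, qy (a + h * s) y))
      - (∫ x in a..b, p x d * (∫ s in (0:ℝ)..1, qx (x + h * s) d))
      + ∫ x in a..b, p x c * (∫ s in (0:ℝ)..1, qx (x + h * s) c) := by
  set Qx : ℝ → ℝ → ℝ := fun x y => ∫ s in (0:ℝ)..1, qx (x + h * s) y with hQx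
  set Qy : ℝ → ℝ → ℝ := fun x y => ∫ s in (0:ℝ)..1, qy (x + h * s) y with hQy
  set D : ℝ → ℝ → ℝ := fun x y => h⁻¹ * (qy (x + h) y - qy x y) with hD
  have cQx : Continuous (fun z : ℝ × ℝ => Qx z.1 z.2) :=
    contInt (f := fun (z : ℝ × ℝ) s => qx (z.1 + h * s) z.2)
      (cont2 hq.cx (by fun_prop) (by fun_prop)) 0 1
  have cQy : Continuous (fun z : ℝ × ℝ => Qy z.1 z.2) :=
    contInt (f := fun (z : ℝ × ℝ) s => qy (z.1 + h * s) z.2)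
      (cont2 hq.cy (by fun_prop) (by fun_prop)) 0 1
  have cD : Continuous (fun z : ℝ × ℝ => D z.1 z.2) := by
    have h1 : Continuous (fun z : ℝ × ℝ => qy (z.1 + h) z.2) :=
      cont2 hq.cy (by fun_prop) (by fun_prop)
    exact continuous_const.mul (h1.sub hq.cy)
  have eQx : ∀ x y, Qx x y = h⁻¹ * (q (x + h) y - q x y) := by
    intro x y
    have h1 : ∀ s ∈ Set.uIcc (0:ℝ) 1, HasDerivAt (fun s => h⁻¹ * q (x + h * s) y)
        (qx (x + h * s) y) s := by
      intro s _
      have h2 : HasDerivAt (fun s : ℝ => x + h * s) h s := by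
        simpa using ((hasDerivAt_id s).const_mul h).const_add x
      have h3 := ((hq.dx (x + h * s) y).comp s h2).const_mul h⁻¹
      exact h3.congr_deriv (by rw [mul_comm (qx _ _) h, inv_mul_cancel_left₀ hh])
    have hc : Continuous fun s => qx (x + h * s) y := cont2 hq.cx (by fun_prop) (by fun_prop)
    have := intervalIntegral.integral_eq_sub_of_hasDerivAt h1 (hc.intervalIntegrable _ _)
    simp only [hQx]
    rw [this]
    simp
    ring
  have eQy : ∀ x y, Qy x y = h⁻¹ * ((∫ t in (0:ℝ)..(x + h), qy t y) - ∫ t in (0:ℝ)..x, qy t y) := by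
    intro x y
    have hc : Continuous fun s => qy s y := cont2 hq.cy (by fun_prop) (by fun_prop)
    simp only [hQy]
    rw [intervalIntegral.integral_comp_add_mul (fun t => qy t y) hh x,
      intervalIntegral.integral_interval_sub_left (hc.intervalIntegrable _ _)
        (hc.intervalIntegrable _ _)]
    simp
  have dQx : ∀ x y, HasDerivAt (fun t => Qx x t) (D x y) y := by
    intro x y
    simp_rw [eQx]
    exact ((hq.dy (x + h) y).sub (hq.dy x y)).const_mul _
  have dQy : ∀ x y, HasDerivAt (fun t => Qy t y) (D x y) x := by
    intro x y
    have hc : Continuous fun s => qy s y := cont2 hq.cy (by fun_prop) (by fun_prop)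
    have h1 : ∀ z, HasDerivAt (fun z => ∫ t in (0:ℝ)..z, qy t y) (qy z y) z := fun z =>
      intervalIntegral.integral_hasDerivAt_right (hc.intervalIntegrable _ _)
        (hc.stronglyMeasurableAtFilter _ _) hc.continuousAt
    simp_rw [eQy]
    exact ((HasDerivAt.comp_add_const x h (h1 (x + h))).sub (h1 x)).const_mul _
  have hA : Continuous (fun z : ℝ × ℝ => px z.1 z.2 * Qy z.1 z.2 + p z.1 z.2 * D z.1 z.2) :=
    (hp.cx.mul cQy).add (hp.c.mul cD)
  have hB : Continuous (fun z : ℝ × ℝ => py z.1 z.2 * Qx z.1 z.2 + p z.1 z.2 * D z.1 z.2) :=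
    (hp.cy.mul cQx).add (hp.c.mul cD)
  have IA : ∫ x in a..b, ∫ y in c..d, (px x y * Qy x y + p x y * D x y) =
      (∫ y in c..d, p b y * Qy b y) - ∫ y in c..d, p a y * Qy a y := by
    rw [swapInt hA]
    have : ∀ y, ∫ x in a..b, (px x y * Qy x y + p x y * D x y) =
        p b y * Qy b y - p a y * Qy a y := by
      intro y
      have c1 : Continuous fun x => px x y := cont2 hp.cx (by fun_prop) (by fun_prop)
      have c2 : Continuous fun x => D x y := cont2 cD (by fun_prop) (by fun_prop)
      exact intervalIntegral.integral_deriv_mul_eq_sub (fun x _ => hp.dx x y) (fun x _ => dQy x y)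
        (c1.intervalIntegrable _ _) (c2.intervalIntegrable _ _)
    simp_rw [this]
    have c1 : ∀ b, Continuous fun y => p b y * Qy b y := fun b =>
      cont2 (f := fun x y => p x y * Qy x y) (hp.c.mul cQy) (by fun_prop) (by fun_prop)
    rw [intervalIntegral.integral_sub ((c1 _).intervalIntegrable _ _)
      ((c1 _).intervalIntegrable _ _)]
  have IB : ∫ x in a..b, ∫ y in c..d, (py x y * Qx x y + p x y * D x y) =
      (∫ x in a..b, p x d * Qx x d) - ∫ x in a..b, p x c * Qx x c := by
    have : ∀ x, ∫ y in c..d, (py x y * Qx x y + p x y * D x y) =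
        p x d * Qx x d - p x c * Qx x c := by
      intro x
      have c1 : Continuous fun y => py x y := cont2 hp.cy (by fun_prop) (by fun_prop)
      have c2 : Continuous fun y => D x y := cont2 cD (by fun_prop) (by fun_prop)
      exact intervalIntegral.integral_deriv_mul_eq_sub (fun y _ => hp.dy x y) (fun y _ => dQx x y)
        (c1.intervalIntegrable _ _) (c2.intervalIntegrable _ _)
    simp_rw [this]
    have c1 : ∀ b, Continuous fun x => p x b * Qx x b := fun b =>
      cont2 (f := fun x y => p x y * Qx x y) (hp.c.mul cQx) (by fun_prop) (by fun_prop)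
    rw [intervalIntegral.integral_sub ((c1 _).intervalIntegrable _ _)
      ((c1 _).intervalIntegrable _ _)]
  have key : ∫ x in a..b, ∫ y in c..d, (px x y * Qy x y - py x y * Qx x y) =
      (∫ x in a..b, ∫ y in c..d, (px x y * Qy x y + p x y * D x y)) -
      ∫ x in a..b, ∫ y in c..d, (py x y * Qx x y + p x y * D x y) := by
    rw [← intervalIntegral.integral_sub ((contInt hA c d).intervalIntegrable _ _)
      ((contInt hB c d).intervalIntegrable _ _)]
    congr 1
    ext x
    have c1 : Continuous fun y => (px x y * Qy x y + p x y * D x y) :=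
      cont2 (f := fun x y => px x y * Qy x y + p x y * D x y) hA (by fun_prop) (by fun_prop)
    have c2 : Continuous fun y => (py x y * Qx x y + p x y * D x y) :=
      cont2 (f := fun x y => py x y * Qx x y + p x y * D x y) hB (by fun_prop) (by fun_prop)
    rw [← intervalIntegral.integral_sub (c1.intervalIntegrable _ _) (c2.intervalIntegrable _ _)]
    congr 1
    ext y
    ring
  rw [key, IA, IB]
  ring

theorem green {p px py q qx qy : ℝ → ℝ → ℝ} (hp : C1 p px py) (hq : C1 q qx qy) (a b c d : ℝ) :
    ∫ x in a..b, ∫ y in c..d, (px x y * qy x y - py x y * qx x y) =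
    (∫ y in c..d, p b y * qy b y) - (∫ y in c..d, p a y * qy a y)
      - (∫ x in a..b, p x d * qx x d) + ∫ x in a..b, p x c * qx x c := by
  have cQ : ∀ {f : ℝ → ℝ → ℝ}, Continuous (fun z : ℝ × ℝ => f z.1 z.2) →
      Continuous (fun w : ℝ × ℝ × ℝ => ∫ s in (0:ℝ)..1, f (w.2.1 + w.1 * s) w.2.2) := by
    intro f hf
    exact contInt (f := fun (w : ℝ × ℝ × ℝ) s => f (w.2.1 + w.1 * s) w.2.2)
      (cont2 hf (by fun_prop) (by fun_prop)) 0 1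
  have cQ' : ∀ {f : ℝ → ℝ → ℝ}, Continuous (fun z : ℝ × ℝ => f z.1 z.2) →
      ∀ {α : Type} [TopologicalSpace α] {e1 e2 e3 : α → ℝ}, Continuous e1 → Continuous e2 →
      Continuous e3 →
      Continuous (fun w : α => ∫ s in (0:ℝ)..1, f (e2 w + e1 w * s) (e3 w)) := by
    intro f hf α _ e1 e2 e3 h1 h2 h3
    exact (cQ hf).comp (h1.prodMk (h2.prodMk h3))
  have cL : Continuous fun h : ℝ =>
      ∫ x in a..b, ∫ y in c..d, (px x y * (∫ s in (0:ℝ)..1, qy (x + h * s) y)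
      - py x y * (∫ s in (0:ℝ)..1, qx (x + h * s) y)) := by
    apply contInt
    apply contInt
    exact ((cont2 hp.cx (by fun_prop) (by fun_prop)).mul
      (cQ' hq.cy (by fun_prop) (by fun_prop) (by fun_prop))).sub
      ((cont2 hp.cy (by fun_prop) (by fun_prop)).mul
      (cQ' hq.cx (by fun_prop) (by fun_prop) (by fun_prop)))
  have cR1 : ∀ b, Continuous fun h : ℝ =>
      (∫ y in c..d, p b y * (∫ s in (0:ℝ)..1, qy (b + h * s) y)) := by
    intro b
    apply contInt
    exact ((cont2 hp.c (by fun_prop) (by fun_prop)).mul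
      (cQ' hq.cy (by fun_prop) (by fun_prop) (by fun_prop)))
  have cR2 : ∀ c, Continuous fun h : ℝ =>
      (∫ x in a..b, p x c * (∫ s in (0:ℝ)..1, qx (x + h * s) c)) := by
    intro b
    apply contInt
    exact ((cont2 hp.c (by fun_prop) (by fun_prop)).mul
      (cQ' hq.cx (by fun_prop) (by fun_prop) (by fun_prop)))
  have cR := ((((cR1 b).sub (cR1 a)).sub (cR2 d)).add (cR2 c))
  have hd : Dense ({0}ᶜ : Set ℝ) := dense_compl_singleton 0
  have := Continuous.ext_on hd cL cR (fun h hh => green_h hp hq a b c d h hh)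
  have := congrFun this 0
  simpa using this


theorem C1.cl {p px py : ℝ → ℝ → ℝ} (hp : C1 p px py) (b : ℝ) : Continuous fun y => p b y :=
  cont2 hp.c continuous_const continuous_id

theorem C1.cr {p px py : ℝ → ℝ → ℝ} (hp : C1 p px py) (b : ℝ) : Continuous fun x => p x b :=
  cont2 hp.c continuous_id continuous_const

theorem C1.cyl {p px py : ℝ → ℝ → ℝ} (hp : C1 p px py) (b : ℝ) : Continuous fun y => py b y :=
  cont2 hp.cy continuous_const continuous_id

theorem C1.cxr {p px py : ℝ → ℝ → ℝ} (hp : C1 p px py) (b : ℝ) : Continuous fun x => px x b :=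
  cont2 hp.cx continuous_id continuous_const

theorem C1.mul {p px py q qx qy : ℝ → ℝ → ℝ} (hp : C1 p px py) (hq : C1 q qx qy) :
    C1 (fun x y => p x y * q x y) (fun x y => px x y * q x y + p x y * qx x y)
      (fun x y => py x y * q x y + p x y * qy x y) where
  dx x y := (hp.dx x y).mul (hq.dx x y)
  dy x y := (hp.dy x y).mul (hq.dy x y)
  c := hp.c.mul hq.c
  cx := (hp.cx.mul hq.c).add (hp.c.mul hq.cx)
  cy := (hp.cy.mul hq.c).add (hp.c.mul hq.cy)

theorem C1.add {p px py q qx qy : ℝ → ℝ → ℝ} (hp : C1 p px py) (hq : C1 q qx qy) :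
    C1 (fun x y => p x y + q x y) (fun x y => px x y + qx x y)
      (fun x y => py x y + qy x y) where
  dx x y := (hp.dx x y).add (hq.dx x y)
  dy x y := (hp.dy x y).add (hq.dy x y)
  c := hp.c.add hq.c
  cx := hp.cx.add hq.cx
  cy := hp.cy.add hq.cy

theorem C1.comp {p px py : ℝ → ℝ → ℝ} (hp : C1 p px py) {F F' : ℝ → ℝ}
    (hF : ∀ x y, HasDerivAt F (F' (p x y)) (p x y))
    (hc : Continuous fun z : ℝ × ℝ => F' (p z.1 z.2)) :
    C1 (fun x y => F (p x y)) (fun x y => F' (p x y) * px x y)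
      (fun x y => F' (p x y) * py x y) where
  dx x y := (hF x y).comp x (hp.dx x y)
  dy x y := (hF x y).comp y (hp.dy x y)
  c := by
    rw [continuous_iff_continuousAt]
    intro z
    exact ContinuousAt.comp (g := F) (f := fun z : ℝ × ℝ => p z.1 z.2)
      (hF z.1 z.2).continuousAt hp.c.continuousAt
  cx := hc.mul hp.cx
  cy := hc.mul hp.cy

theorem int2_sub {f g : ℝ → ℝ → ℝ} (hf : Continuous (fun z : ℝ × ℝ => f z.1 z.2))
    (hg : Continuous (fun z : ℝ × ℝ => g z.1 z.2)) (a b c d : ℝ) :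
    ∫ x in a..b, ∫ y in c..d, (f x y - g x y) =
      (∫ x in a..b, ∫ y in c..d, f x y) - ∫ x in a..b, ∫ y in c..d, g x y := by
  rw [← intervalIntegral.integral_sub ((contInt hf c d).intervalIntegrable _ _)
      ((contInt hg c d).intervalIntegrable _ _)]
  congr 1
  ext x
  exact intervalIntegral.integral_sub
    ((cont2 hf continuous_const continuous_id).intervalIntegrable _ _)
    ((cont2 hg continuous_const continuous_id).intervalIntegrable _ _)

theorem green_sub {p px py q qx qy p' px' py' q' qx' qy' : ℝ → ℝ → ℝ} (hp : C1 p px py)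
    (hq : C1 q qx qy) (hp' : C1 p' px' py') (hq' : C1 q' qx' qy') (a b c d : ℝ) :
    ∫ x in a..b, ∫ y in c..d, ((px x y * qy x y - py x y * qx x y) -
      (px' x y * qy' x y - py' x y * qx' x y)) =
    (∫ x in a..b, ∫ y in c..d, (px x y * qy x y - py x y * qx x y)) -
      ∫ x in a..b, ∫ y in c..d, (px' x y * qy' x y - py' x y * qx' x y) :=
  int2_sub (f := fun x y => (px x y * qy x y - py x y * qx x y))
    (g := fun x y => (px' x y * qy' x y - py' x y * qx' x y))
    ((hp.cx.mul hq.cy).sub (hp.cy.mul hq.cx))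
    ((hp'.cx.mul hq'.cy).sub (hp'.cy.mul hq'.cx)) a b c d

theorem int2_mono {f g : ℝ → ℝ → ℝ} (hf : Continuous (fun z : ℝ × ℝ => f z.1 z.2))
    (hg : Continuous (fun z : ℝ × ℝ => g z.1 z.2)) {a b c d : ℝ} (hab : a ≤ b) (hcd : c ≤ d)
    (h : ∀ x ∈ Set.Icc a b, ∀ y ∈ Set.Icc c d, f x y ≤ g x y) :
    ∫ x in a..b, ∫ y in c..d, f x y ≤ ∫ x in a..b, ∫ y in c..d, g x y := by
  apply intervalIntegral.integral_mono_on hab ((contInt hf c d).intervalIntegrable _ _)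
      ((contInt hg c d).intervalIntegrable _ _)
  intro x hx
  exact intervalIntegral.integral_mono_on hcd
    ((cont2 hf continuous_const continuous_id).intervalIntegrable _ _)
    ((cont2 hg continuous_const continuous_id).intervalIntegrable _ _) (h x hx)

theorem int2_subset {f : ℝ → ℝ → ℝ} (hf : Continuous (fun z : ℝ × ℝ => f z.1 z.2))
    (h0 : ∀ x y, 0 ≤ f x y) {a b c d a' b' c' d' : ℝ} (haa : a' ≤ a) (hab : a ≤ b) (hbb : b ≤ b')
    (hcc : c' ≤ c) (hcd : c ≤ d) (hdd : d ≤ d') :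
    ∫ x in a..b, ∫ y in c..d, f x y ≤ ∫ x in a'..b', ∫ y in c'..d', f x y := by
  have h1 : ∫ x in a..b, ∫ y in c..d, f x y ≤ ∫ x in a..b, ∫ y in c'..d', f x y := by
    apply intervalIntegral.integral_mono_on hab ((contInt hf c d).intervalIntegrable _ _)
      ((contInt hf c' d').intervalIntegrable _ _)
    intro x hx
    exact intervalIntegral.integral_mono_interval hcc hcd hdd
      (Eventually.of_forall fun y => h0 x y)
      ((cont2 hf continuous_const continuous_id).intervalIntegrable _ _)
  refine h1.trans ?_
  exact intervalIntegral.integral_mono_interval haa hab hbb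
      (Eventually.of_forall fun x => intervalIntegral.integral_nonneg (by linarith)
        (fun y _ => h0 x y))
      ((contInt hf c' d').intervalIntegrable _ _)

theorem C1.s {u ux uy v vx vy : ℝ → ℝ → ℝ} (hu : C1 u ux uy) (hv : C1 v vx vy) :
    C1 (fun x y => u x y ^ 2 + v x y ^ 2) (fun x y => 2 * (u x y * ux x y + v x y * vx x y))
      (fun x y => 2 * (u x y * uy x y + v x y * vy x y)) := by
  have h := (hu.mul hu).add (hv.mul hv)
  convert h using 3 <;> ring

theorem wgreen {u ux uy v vx vy w wx wy : ℝ → ℝ → ℝ} (hu : C1 u ux uy) (hv : C1 v vx vy)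
    (hw : C1 w wx wy) {F F' : ℝ → ℝ}
    (hF : ∀ x y, HasDerivAt F (F' (u x y ^ 2 + v x y ^ 2)) (u x y ^ 2 + v x y ^ 2))
    (hc : Continuous fun z : ℝ × ℝ => F' (u z.1 z.2 ^ 2 + v z.1 z.2 ^ 2)) (a b c d : ℝ) :
    ∫ x in a..b, ∫ y in c..d,
      (2 * w x y * (F (u x y ^ 2 + v x y ^ 2) +
          (u x y ^ 2 + v x y ^ 2) * F' (u x y ^ 2 + v x y ^ 2)) *
          (ux x y * vy x y - uy x y * vx x y)
        + F (u x y ^ 2 + v x y ^ 2) * (wx x y * (u x y * vy x y - v x y * uy x y)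
          - wy x y * (u x y * vx x y - v x y * ux x y))) =
    (∫ y in c..d, w b y * F (u b y ^ 2 + v b y ^ 2) * (u b y * vy b y - v b y * uy b y))
    - (∫ y in c..d, w a y * F (u a y ^ 2 + v a y ^ 2) * (u a y * vy a y - v a y * uy a y))
    - (∫ x in a..b, w x d * F (u x d ^ 2 + v x d ^ 2) * (u x d * vx x d - v x d * ux x d))
    + ∫ x in a..b, w x c * F (u x c ^ 2 + v x c ^ 2) * (u x c * vx x c - v x c * ux x c) := by
  have hs := (hu.s hv).comp hF hc
  have hP := (hw.mul hs).mul hu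
  have hQ := (hw.mul hs).mul hv
  have e := green_sub hP hv hQ hu a b c d
  rw [green hP hv, green hQ hu] at e
  have B1 : ∀ b, ∫ y in c..d, w b y * F (u b y ^ 2 + v b y ^ 2) *
      (u b y * vy b y - v b y * uy b y) =
      (∫ y in c..d, w b y * F (u b y ^ 2 + v b y ^ 2) * u b y * vy b y) -
      ∫ y in c..d, w b y * F (u b y ^ 2 + v b y ^ 2) * v b y * uy b y := by
    intro b
    have c1 : Continuous fun y => w b y * F (u b y ^ 2 + v b y ^ 2) * u b y * vy b y :=
      (hP.cl b).mul (hv.cyl b)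
    have c2 : Continuous fun y => w b y * F (u b y ^ 2 + v b y ^ 2) * v b y * uy b y :=
      (hQ.cl b).mul (hu.cyl b)
    rw [← intervalIntegral.integral_sub (c1.intervalIntegrable _ _) (c2.intervalIntegrable _ _)]
    congr 1
    ext y
    ring
  have B2 : ∀ c, ∫ x in a..b, w x c * F (u x c ^ 2 + v x c ^ 2) *
      (u x c * vx x c - v x c * ux x c) =
      (∫ x in a..b, w x c * F (u x c ^ 2 + v x c ^ 2) * u x c * vx x c) -
      ∫ x in a..b, w x c * F (u x c ^ 2 + v x c ^ 2) * v x c * ux x c := by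
    intro b
    have c1 : Continuous fun x => w x b * F (u x b ^ 2 + v x b ^ 2) * u x b * vx x b :=
      (hP.cr b).mul (hv.cxr b)
    have c2 : Continuous fun x => w x b * F (u x b ^ 2 + v x b ^ 2) * v x b * ux x b :=
      (hQ.cr b).mul (hu.cxr b)
    rw [← intervalIntegral.integral_sub (c1.intervalIntegrable _ _) (c2.intervalIntegrable _ _)]
    congr 1
    ext y
    ring
  rw [B1, B1, B2, B2]
  refine Eq.trans ?_ (e.trans (by ring))
  congr 1
  ext x
  congr 1
  ext y
  ring

noncomputable def ell (N ε s : ℝ) : ℝ := 1 + Real.log N - Real.log (s + ε)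

theorem ell_ge {N ε s : ℝ} (hs : 0 ≤ s) (hε : 0 < ε) (hN : s + ε ≤ N) : 1 ≤ ell N ε s := by
  have := Real.log_le_log (by linarith : 0 < s + ε) hN
  unfold ell
  linarith

theorem ell_deriv {N ε s : ℝ} (hs : 0 ≤ s) (hε : 0 < ε) :
    HasDerivAt (ell N ε) (-(s + ε)⁻¹) s := by
  have h1 : HasDerivAt (fun s : ℝ => s + ε) 1 s := (hasDerivAt_id s).add_const ε
  have h2 := (h1.log (by linarith)).const_sub (1 + Real.log N)
  exact h2.congr_deriv (by simp)

theorem F_deriv {N ε s : ℝ} (hs : 0 ≤ s) (hε : 0 < ε) (hN : s + ε ≤ N) :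
    HasDerivAt (fun s => ((s + ε) * ell N ε s)⁻¹)
      (-(ell N ε s - 1) / ((s + ε) * ell N ε s) ^ 2) s := by
  have h0 := ell_ge hs hε hN
  have h1 : HasDerivAt (fun s : ℝ => s + ε) 1 s := (hasDerivAt_id s).add_const ε
  have h2 := (h1.mul (ell_deriv (N := N) hs hε)).inv
    (by simp only [Pi.mul_apply]; exact mul_ne_zero (by linarith) (by linarith))
  refine h2.congr_deriv ?_
  have : s + ε ≠ 0 := by linarith
  have : ell N ε s ≠ 0 := by linarith
  simp only [Pi.mul_apply]
  field_simp
  ring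

theorem cacc_pt {K ε s l η ηx ηy u v ux uy vx vy : ℝ} (hK : 0 < K) (hε : 0 < ε)
    (hs : s = u ^ 2 + v ^ 2) (hl : 1 ≤ l)
    (hJ : ux ^ 2 + uy ^ 2 + vx ^ 2 + vy ^ 2 ≤ K * (ux * vy - uy * vx)) :
    η ^ 2 * ((ux ^ 2 + uy ^ 2 + vx ^ 2 + vy ^ 2) / ((s + ε) * l ^ 2)) / K - K * (ηx ^ 2 + ηy ^ 2) ≤
    2 * η ^ 2 * (((s + ε) * l)⁻¹ + s * (-(l - 1) / ((s + ε) * l) ^ 2)) * (ux * vy - uy * vx)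
      + ((s + ε) * l)⁻¹ * (2 * η * ηx * (u * vy - v * uy) - 2 * η * ηy * (u * vx - v * ux)) := by
  set E := ux ^ 2 + uy ^ 2 + vx ^ 2 + vy ^ 2 with hE
  set J := ux * vy - uy * vx with hJd
  set G := ηx ^ 2 + ηy ^ 2 with hG
  set T := ηx * (u * vy - v * uy) - ηy * (u * vx - v * ux) with hT
  have hs0 : 0 ≤ s := by rw [hs]; positivity
  have hse : 0 < s + ε := by linarith
  have hl0 : 0 < l := by linarith
  have hE0 : 0 ≤ E := by positivity
  have hG0 : 0 ≤ G := by positivity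
  set A := ((s + ε) * l ^ 2)⁻¹ with hA
  have hA0 : 0 < A := by positivity
  set F := ((s + ε) * l)⁻¹ with hF
  have hEJ : E / K ≤ J := by rw [div_le_iff₀ hK]; linarith
  have hJ0 : 0 ≤ J := le_trans (by positivity) hEJ
  have h1 : A ≤ F + s * (-(l - 1) / ((s + ε) * l) ^ 2) := by
    have : F + s * (-(l - 1) / ((s + ε) * l) ^ 2) - A = ε * (l - 1) / ((s + ε) * l) ^ 2 := by
      rw [hF, hA]; field_simp; ring
    have h2 : 0 ≤ ε * (l - 1) / ((s + ε) * l) ^ 2 :=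
      div_nonneg (mul_nonneg hε.le (by linarith)) (by positivity)
    linarith
  have h2 : F ^ 2 * s ≤ A := by
    have : A - F ^ 2 * s = ε / ((s + ε) * l) ^ 2 := by
      rw [hF, hA]; field_simp; ring
    have h2 : 0 ≤ ε / ((s + ε) * l) ^ 2 := by positivity
    linarith
  have h3 : T ^ 2 ≤ G * (s * E) := by
    have a1 : T ^ 2 ≤ G * ((u * vy - v * uy) ^ 2 + (u * vx - v * ux) ^ 2) := by
      rw [hT, hG]; nlinarith [sq_nonneg (ηx * (u * vx - v * ux) + ηy * (u * vy - v * uy))]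
    have a2 : (u * vy - v * uy) ^ 2 + (u * vx - v * ux) ^ 2 ≤ s * E := by
      rw [hs, hE]; nlinarith [sq_nonneg (u * uy + v * vy), sq_nonneg (u * ux + v * vx)]
    exact a1.trans (mul_le_mul_of_nonneg_left a2 hG0)
  clear_value E J G T A F
  set P := η ^ 2 * (A * E) / K with hP
  have hP0 : 0 ≤ P := by positivity
  have h4 : (η * F * T) ^ 2 ≤ P * (K * G) := by
    have : P * (K * G) = η ^ 2 * (G * (A * E)) := by rw [hP]; field_simp
    rw [this]
    have b1 : F ^ 2 * T ^ 2 ≤ F ^ 2 * (G * (s * E)) := mul_le_mul_of_nonneg_left h3 (by positivity)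
    have b2 : (F ^ 2 * s) * (G * E) ≤ A * (G * E) := mul_le_mul_of_nonneg_right h2 (by positivity)
    have b3 : F ^ 2 * T ^ 2 ≤ G * (A * E) := by
      calc F ^ 2 * T ^ 2 ≤ F ^ 2 * (G * (s * E)) := b1
        _ = (F ^ 2 * s) * (G * E) := by ring
        _ ≤ A * (G * E) := b2
        _ = _ := by ring
    calc (η * F * T) ^ 2 = η ^ 2 * (F ^ 2 * T ^ 2) := by ring
      _ ≤ _ := mul_le_mul_of_nonneg_left b3 (sq_nonneg η)
  have h5 : -(P + K * G) ≤ 2 * (η * F * T) := by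
    have hKG : 0 ≤ K * G := by positivity
    refine (abs_le_of_sq_le_sq' ?_ (by linarith)).1
    have : (2 * (η * F * T)) ^ 2 = 4 * (η * F * T) ^ 2 := by ring
    rw [this]
    have : (P + K * G) ^ 2 = 4 * (P * (K * G)) + (P - K * G) ^ 2 := by ring
    rw [this]
    linarith [sq_nonneg (P - K * G)]
  have h6 : 2 * P ≤ 2 * η ^ 2 * (F + s * (-(l - 1) / ((s + ε) * l) ^ 2)) * J := by
    have c1 : A * (E / K) ≤ (F + s * (-(l - 1) / ((s + ε) * l) ^ 2)) * J :=
      mul_le_mul h1 hEJ (by positivity) (hA0.le.trans h1)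
    have c2 := mul_le_mul_of_nonneg_left c1 (by positivity : 0 ≤ 2 * η ^ 2)
    calc 2 * P = 2 * η ^ 2 * (A * (E / K)) := by rw [hP]; ring
      _ ≤ _ := c2
      _ = _ := by ring
  have h7 : η ^ 2 * (E / ((s + ε) * l ^ 2)) / K = P := by
    rw [hP, hA]; ring
  rw [h7]
  have h8 : F * (2 * η * ηx * (u * vy - v * uy) - 2 * η * ηy * (u * vx - v * ux))
      = 2 * (η * F * T) := by rw [hT]; ring
  rw [h8]
  linarith


theorem eta_C1 (r : ℝ) : C1 (fun x y => ((r ^ 2 - x ^ 2) * (r ^ 2 - y ^ 2)) ^ 2)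
    (fun x y => 2 * ((r ^ 2 - x ^ 2) * (r ^ 2 - y ^ 2)) * (-2 * x * (r ^ 2 - y ^ 2)))
    (fun x y => 2 * ((r ^ 2 - x ^ 2) * (r ^ 2 - y ^ 2)) * (-2 * y * (r ^ 2 - x ^ 2))) where
  dx x y := by
    have h1 : HasDerivAt (fun t : ℝ => r ^ 2 - t ^ 2) (-(2 * x)) x := by
      simpa using (hasDerivAt_pow 2 x).const_sub (r ^ 2)
    exact ((h1.mul_const (r ^ 2 - y ^ 2)).pow 2).congr_deriv (by push_cast; ring)
  dy x y := by
    have h1 : HasDerivAt (fun t : ℝ => r ^ 2 - t ^ 2) (-(2 * y)) y := by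
      simpa using (hasDerivAt_pow 2 y).const_sub (r ^ 2)
    exact ((h1.const_mul (r ^ 2 - x ^ 2)).pow 2).congr_deriv (by push_cast; ring)
  c := by fun_prop
  cx := by fun_prop
  cy := by fun_prop

theorem cacc1 {u ux uy v vx vy : ℝ → ℝ → ℝ} (hu : C1 u ux uy) (hv : C1 v vx vy)
    {K M r : ℝ} (hK : 0 < K) (hr : 0 < r) (hM : ∀ x y, u x y ^ 2 + v x y ^ 2 ≤ M)
    (hQ : ∀ x ∈ Set.Icc (-r) r, ∀ y ∈ Set.Icc (-r) r,
      ux x y ^ 2 + uy x y ^ 2 + vx x y ^ 2 + vy x y ^ 2 ≤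
        K * (ux x y * vy x y - uy x y * vx x y)) (ε : ℝ) (hε : 0 < ε) (hε1 : ε ≤ 1) :
    ∫ x in (-r)..r, ∫ y in (-r)..r, (((r ^ 2 - x ^ 2) * (r ^ 2 - y ^ 2)) ^ 2 *
      ((ux x y ^ 2 + uy x y ^ 2 + vx x y ^ 2 + vy x y ^ 2) /
        ((u x y ^ 2 + v x y ^ 2 + ε) * ell (M + 1) ε (u x y ^ 2 + v x y ^ 2) ^ 2)) / K -
       K * ((-2 * x * (r ^ 2 - y ^ 2)) ^ 2 + (-2 * y * (r ^ 2 - x ^ 2)) ^ 2)) ≤ 0 := by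
  have hs0 : ∀ x y, 0 ≤ u x y ^ 2 + v x y ^ 2 := fun x y => by positivity
  have hs1 : ∀ x y, u x y ^ 2 + v x y ^ 2 + ε ≤ M + 1 := fun x y => by linarith [hM x y]
  have hl1 : ∀ x y, 1 ≤ ell (M + 1) ε (u x y ^ 2 + v x y ^ 2) := fun x y =>
    ell_ge (hs0 x y) hε (hs1 x y)
  have cs := (hu.s hv).c
  have cl : Continuous fun z : ℝ × ℝ => ell (M + 1) ε (u z.1 z.2 ^ 2 + v z.1 z.2 ^ 2) := by
    rw [continuous_iff_continuousAt]
    intro z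
    exact ContinuousAt.comp (g := ell (M + 1) ε) (f := fun z : ℝ × ℝ => u z.1 z.2 ^ 2 + v z.1 z.2 ^ 2)
      (ell_deriv (hs0 z.1 z.2) hε).continuousAt cs.continuousAt
  have n1 : ∀ z : ℝ × ℝ, u z.1 z.2 ^ 2 + v z.1 z.2 ^ 2 + ε ≠ 0 := fun z => by
    have := hs0 z.1 z.2
    positivity
  have n2 : ∀ z : ℝ × ℝ, ell (M + 1) ε (u z.1 z.2 ^ 2 + v z.1 z.2 ^ 2) ≠ 0 := fun z => by
    have := hl1 z.1 z.2
    positivity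
  have hc : Continuous fun z : ℝ × ℝ =>
      (fun s => -(ell (M + 1) ε s - 1) / ((s + ε) * ell (M + 1) ε s) ^ 2)
        (u z.1 z.2 ^ 2 + v z.1 z.2 ^ 2) := by
    apply Continuous.div
    · exact (cl.sub continuous_const).neg
    · exact ((cs.add continuous_const).mul cl).pow 2
    · intro z
      exact pow_ne_zero 2 (mul_ne_zero (n1 z) (n2 z))
  have key := wgreen hu hv (eta_C1 r)
    (F := fun s => ((s + ε) * ell (M + 1) ε s)⁻¹)
    (F' := fun s => -(ell (M + 1) ε s - 1) / ((s + ε) * ell (M + 1) ε s) ^ 2)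
    (fun x y => F_deriv (hs0 x y) hε (hs1 x y)) hc (-r) r (-r) r
  have z0 : ∀ y : ℝ, ((r ^ 2 - (-r) ^ 2) * (r ^ 2 - y ^ 2)) ^ 2 = 0 := fun y => by ring
  have z1 : ∀ y : ℝ, ((r ^ 2 - r ^ 2) * (r ^ 2 - y ^ 2)) ^ 2 = 0 := fun y => by ring
  have z2 : ∀ y : ℝ, ((r ^ 2 - y ^ 2) * (r ^ 2 - (-r) ^ 2)) ^ 2 = 0 := fun y => by ring
  have z3 : ∀ y : ℝ, ((r ^ 2 - y ^ 2) * (r ^ 2 - r ^ 2)) ^ 2 = 0 := fun y => by ring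
  simp only [z0, z1, z2, z3, zero_mul, intervalIntegral.integral_zero, sub_zero, add_zero] at key
  rw [← key]
  have cu := hu.c
  have cux := hu.cx
  have cuy := hu.cy
  have cv := hv.c
  have cvx := hv.cx
  have cvy := hv.cy
  apply int2_mono _ _ (by linarith) (by linarith)
  · intro x hx y hy
    refine (cacc_pt (η := (r ^ 2 - x ^ 2) * (r ^ 2 - y ^ 2)) (u := u x y) (v := v x y) hK hε rfl
      (hl1 x y) (hQ x hx y hy)).trans (le_of_eq ?_)
    ring
  · refine Continuous.sub (Continuous.div_const (Continuous.mul (by fun_prop) (Continuous.div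
      ((((cux.pow 2).add (cuy.pow 2)).add (cvx.pow 2)).add (cvy.pow 2))
      ((cs.add continuous_const).mul (cl.pow 2))
      (fun z => mul_ne_zero (n1 z) (pow_ne_zero 2 (n2 z))))) _) (by fun_prop)
  · have cF : Continuous fun z : ℝ × ℝ => ((u z.1 z.2 ^ 2 + v z.1 z.2 ^ 2 + ε) *
        ell (M + 1) ε (u z.1 z.2 ^ 2 + v z.1 z.2 ^ 2))⁻¹ :=
      ((cs.add continuous_const).mul cl).inv₀ (fun z => mul_ne_zero (n1 z) (n2 z))
    refine Continuous.add (Continuous.mul (Continuous.mul (by fun_prop)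
      (cF.add (cs.mul hc))) ((cux.mul cvy).sub (cuy.mul cvx))) (cF.mul ?_)
    fun_prop

theorem gx_pt {ε s l u v ux uy vx vy η : ℝ} (hε : 0 < ε)
    (hs : s = u ^ 2 + v ^ 2) (hl : 1 ≤ l) :
    η * |2 * (u * ux + v * vx) / ((s + ε) * l)| ≤
      |η| + |η| * 4 * ((ux ^ 2 + uy ^ 2 + vx ^ 2 + vy ^ 2) / ((s + ε) * l ^ 2)) := by
  set g := 2 * (u * ux + v * vx) / ((s + ε) * l) with hg
  have hs0 : 0 ≤ s := by rw [hs]; positivity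
  have hse : 0 < s + ε := by linarith
  have hl0 : 0 < l := by linarith
  have h1 : |g| ≤ 1 + g ^ 2 := by nlinarith [sq_abs g, sq_nonneg (|g| - 1), abs_nonneg g]
  have h2 : g ^ 2 ≤ 4 * ((ux ^ 2 + uy ^ 2 + vx ^ 2 + vy ^ 2) / ((s + ε) * l ^ 2)) := by
    rw [hg, div_pow, ← mul_div_assoc, div_le_div_iff₀ (by positivity) (by positivity)]
    have a1 : (u * ux + v * vx) ^ 2 ≤ (s + ε) * (ux ^ 2 + uy ^ 2 + vx ^ 2 + vy ^ 2) := by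
      have b1 : (u * ux + v * vx) ^ 2 ≤ s * (ux ^ 2 + vx ^ 2) := by
        rw [hs]; nlinarith [sq_nonneg (u * vx - v * ux)]
      have b2 : s * (ux ^ 2 + vx ^ 2) ≤ (s + ε) * (ux ^ 2 + uy ^ 2 + vx ^ 2 + vy ^ 2) := by
        apply mul_le_mul (by linarith) _ (by positivity) (by positivity)
        nlinarith [sq_nonneg uy, sq_nonneg vy]
      linarith
    have a2 := mul_le_mul_of_nonneg_right a1 (by positivity : 0 ≤ 4 * ((s + ε) * l ^ 2))
    calc _ = (u * ux + v * vx) ^ 2 * (4 * ((s + ε) * l ^ 2)) := by ring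
      _ ≤ _ := a2
      _ = _ := by ring
  calc η * |g| ≤ |η| * |g| := mul_le_mul_of_nonneg_right (le_abs_self η) (abs_nonneg g)
    _ ≤ |η| * (1 + 4 * ((ux ^ 2 + uy ^ 2 + vx ^ 2 + vy ^ 2) / ((s + ε) * l ^ 2))) :=
      mul_le_mul_of_nonneg_left (by linarith) (abs_nonneg η)
    _ = _ := by ring

theorem cacc {u ux uy v vx vy : ℝ → ℝ → ℝ} (hu : C1 u ux uy) (hv : C1 v vx vy)
    {K M r ρ : ℝ} (hK : 0 < K) (hρ : 0 < ρ) (hr : ρ < r) (hM : ∀ x y, u x y ^ 2 + v x y ^ 2 ≤ M)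
    (hQ : ∀ x ∈ Set.Icc (-r) r, ∀ y ∈ Set.Icc (-r) r,
      ux x y ^ 2 + uy x y ^ 2 + vx x y ^ 2 + vy x y ^ 2 ≤
        K * (ux x y * vy x y - uy x y * vx x y)) :
    ∃ C, ∀ ε : ℝ, 0 < ε → ε ≤ 1 →
    (Continuous fun z : ℝ × ℝ => 2 * (u z.1 z.2 * ux z.1 z.2 + v z.1 z.2 * vx z.1 z.2) /
        ((u z.1 z.2 ^ 2 + v z.1 z.2 ^ 2 + ε) * ell (M + 1) ε (u z.1 z.2 ^ 2 + v z.1 z.2 ^ 2))) ∧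
    ∫ x in (-ρ)..ρ, ∫ y in (-ρ)..ρ, |2 * (u x y * ux x y + v x y * vx x y) /
        ((u x y ^ 2 + v x y ^ 2 + ε) * ell (M + 1) ε (u x y ^ 2 + v x y ^ 2))| ≤ C := by
  have hr0 : 0 < r := hρ.trans hr
  set κ : ℝ := ((r ^ 2 - ρ ^ 2) * (r ^ 2 - ρ ^ 2)) ^ 2 with hκ
  have hκ1 : 0 < r ^ 2 - ρ ^ 2 := by nlinarith
  have hκ0 : 0 < κ := by positivity
  set C0 : ℝ := ∫ x in (-r)..r, ∫ y in (-r)..r, (((r ^ 2 - x ^ 2) * (r ^ 2 - y ^ 2)) ^ 2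
    + 4 * K * (K * ((-2 * x * (r ^ 2 - y ^ 2)) ^ 2 + (-2 * y * (r ^ 2 - x ^ 2)) ^ 2))) with hC0
  refine ⟨C0 / κ, fun ε hε hε1 => ?_⟩
  have hs0 : ∀ x y, 0 ≤ u x y ^ 2 + v x y ^ 2 := fun x y => by positivity
  have hs1 : ∀ x y, u x y ^ 2 + v x y ^ 2 + ε ≤ M + 1 := fun x y => by linarith [hM x y]
  have hl1 : ∀ x y, 1 ≤ ell (M + 1) ε (u x y ^ 2 + v x y ^ 2) := fun x y =>
    ell_ge (hs0 x y) hε (hs1 x y)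
  have cs := (hu.s hv).c
  have cl : Continuous fun z : ℝ × ℝ => ell (M + 1) ε (u z.1 z.2 ^ 2 + v z.1 z.2 ^ 2) := by
    rw [continuous_iff_continuousAt]
    intro z
    exact ContinuousAt.comp (g := ell (M + 1) ε) (f := fun z : ℝ × ℝ => u z.1 z.2 ^ 2 + v z.1 z.2 ^ 2)
      (ell_deriv (hs0 z.1 z.2) hε).continuousAt cs.continuousAt
  have n1 : ∀ z : ℝ × ℝ, u z.1 z.2 ^ 2 + v z.1 z.2 ^ 2 + ε ≠ 0 := fun z => by
    have := hs0 z.1 z.2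
    positivity
  have n2 : ∀ z : ℝ × ℝ, ell (M + 1) ε (u z.1 z.2 ^ 2 + v z.1 z.2 ^ 2) ≠ 0 := fun z => by
    have := hl1 z.1 z.2
    positivity
  have cu := hu.c
  have cux := hu.cx
  have cuy := hu.cy
  have cv := hv.c
  have cvx := hv.cx
  have cvy := hv.cy
  have cg : Continuous fun z : ℝ × ℝ => 2 * (u z.1 z.2 * ux z.1 z.2 + v z.1 z.2 * vx z.1 z.2) /
        ((u z.1 z.2 ^ 2 + v z.1 z.2 ^ 2 + ε) * ell (M + 1) ε (u z.1 z.2 ^ 2 + v z.1 z.2 ^ 2)) :=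
    Continuous.div (by fun_prop) ((cs.add continuous_const).mul cl)
      (fun z => mul_ne_zero (n1 z) (n2 z))
  refine ⟨cg, ?_⟩
  have cη : Continuous fun z : ℝ × ℝ => ((r ^ 2 - z.1 ^ 2) * (r ^ 2 - z.2 ^ 2)) ^ 2 := by fun_prop
  have cE : Continuous fun z : ℝ × ℝ => ((r ^ 2 - z.1 ^ 2) * (r ^ 2 - z.2 ^ 2)) ^ 2 *
      ((ux z.1 z.2 ^ 2 + uy z.1 z.2 ^ 2 + vx z.1 z.2 ^ 2 + vy z.1 z.2 ^ 2) /
        ((u z.1 z.2 ^ 2 + v z.1 z.2 ^ 2 + ε) *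
          ell (M + 1) ε (u z.1 z.2 ^ 2 + v z.1 z.2 ^ 2) ^ 2)) / K -
       K * ((-2 * z.1 * (r ^ 2 - z.2 ^ 2)) ^ 2 + (-2 * z.2 * (r ^ 2 - z.1 ^ 2)) ^ 2) :=
    Continuous.sub (Continuous.div_const (Continuous.mul (by fun_prop) (Continuous.div
      ((((cux.pow 2).add (cuy.pow 2)).add (cvx.pow 2)).add (cvy.pow 2))
      ((cs.add continuous_const).mul (cl.pow 2))
      (fun z => mul_ne_zero (n1 z) (pow_ne_zero 2 (n2 z))))) _) (by fun_prop)
  have c1 := cacc1 hu hv hK hr0 hM hQ ε hε hε1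
  set g : ℝ → ℝ → ℝ := fun x y => 2 * (u x y * ux x y + v x y * vx x y) /
        ((u x y ^ 2 + v x y ^ 2 + ε) * ell (M + 1) ε (u x y ^ 2 + v x y ^ 2)) with hg
  set e : ℝ → ℝ → ℝ := fun x y => ((r ^ 2 - x ^ 2) * (r ^ 2 - y ^ 2)) ^ 2 *
      ((ux x y ^ 2 + uy x y ^ 2 + vx x y ^ 2 + vy x y ^ 2) /
        ((u x y ^ 2 + v x y ^ 2 + ε) * ell (M + 1) ε (u x y ^ 2 + v x y ^ 2) ^ 2)) / K -
       K * ((-2 * x * (r ^ 2 - y ^ 2)) ^ 2 + (-2 * y * (r ^ 2 - x ^ 2)) ^ 2) with he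
  -- full square estimate
  have d1 : ∫ x in (-r)..r, ∫ y in (-r)..r, (((r ^ 2 - x ^ 2) * (r ^ 2 - y ^ 2)) ^ 2 * |g x y|
      - 4 * K * e x y) ≤ C0 := by
    apply int2_mono _ _ (by linarith) (by linarith)
    · intro x hx y hy
      have := gx_pt (ε := ε) (η := ((r ^ 2 - x ^ 2) * (r ^ 2 - y ^ 2)) ^ 2) (u := u x y)
        (v := v x y) (ux := ux x y) (uy := uy x y) (vx := vx x y) (vy := vy x y) hε rfl (hl1 x y)
      rw [abs_of_nonneg (by positivity : 0 ≤ ((r ^ 2 - x ^ 2) * (r ^ 2 - y ^ 2)) ^ 2)] at this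
      have h4 : 4 * K * e x y = ((r ^ 2 - x ^ 2) * (r ^ 2 - y ^ 2)) ^ 2 * 4 *
        ((ux x y ^ 2 + uy x y ^ 2 + vx x y ^ 2 + vy x y ^ 2) /
        ((u x y ^ 2 + v x y ^ 2 + ε) * ell (M + 1) ε (u x y ^ 2 + v x y ^ 2) ^ 2)) -
        4 * K * (K * ((-2 * x * (r ^ 2 - y ^ 2)) ^ 2 + (-2 * y * (r ^ 2 - x ^ 2)) ^ 2)) := by
        simp only [he]
        generalize (ux x y ^ 2 + uy x y ^ 2 + vx x y ^ 2 + vy x y ^ 2) /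
          ((u x y ^ 2 + v x y ^ 2 + ε) * ell (M + 1) ε (u x y ^ 2 + v x y ^ 2) ^ 2) = X
        field_simp
      linarith
    · exact (cη.mul cg.abs).sub (continuous_const.mul cE)
    · fun_prop
  rw [int2_sub (f := fun x y => ((r ^ 2 - x ^ 2) * (r ^ 2 - y ^ 2)) ^ 2 * |g x y|)
    (g := fun x y => 4 * K * e x y) (cη.mul cg.abs) (continuous_const.mul cE)] at d1
  simp only [intervalIntegral.integral_const_mul] at d1
  have d2 : ∫ x in (-r)..r, ∫ y in (-r)..r, ((r ^ 2 - x ^ 2) * (r ^ 2 - y ^ 2)) ^ 2 * |g x y|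
      ≤ C0 := by nlinarith
  have d3 := int2_subset (f := fun x y => ((r ^ 2 - x ^ 2) * (r ^ 2 - y ^ 2)) ^ 2 * |g x y|)
    (cη.mul cg.abs) (fun x y => by positivity) (by linarith : -r ≤ -ρ) (by linarith : -ρ ≤ ρ)
    (by linarith : ρ ≤ r) (by linarith : -r ≤ -ρ) (by linarith : -ρ ≤ ρ) (by linarith : ρ ≤ r)
  have d4 := int2_mono (f := fun x y => κ * |g x y|)
    (g := fun x y => ((r ^ 2 - x ^ 2) * (r ^ 2 - y ^ 2)) ^ 2 * |g x y|) (continuous_const.mul cg.abs)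
    (cη.mul cg.abs) (by linarith : -ρ ≤ ρ) (by linarith : -ρ ≤ ρ) (by
      intro x hx y hy
      apply mul_le_mul_of_nonneg_right _ (abs_nonneg _)
      have e1 : x ^ 2 ≤ ρ ^ 2 := sq_le_sq' hx.1 hx.2
      have e2 : y ^ 2 ≤ ρ ^ 2 := sq_le_sq' hy.1 hy.2
      apply pow_le_pow_left₀ (by positivity)
      apply mul_le_mul (by linarith) (by linarith) hκ1.le (by linarith))
  simp only [intervalIntegral.integral_const_mul] at d4
  rw [le_div_iff₀ hκ0]
  linarith


theorem osc_le {f g : ℝ → ℝ} (hf : ∀ x, HasDerivAt f (g x) x) (hg : Continuous g) {a b : ℝ}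
    {x0 x1 : ℝ} (h0 : x0 ∈ Set.Icc a b) (h1 : x1 ∈ Set.Icc a b) :
    f x0 - f x1 ≤ ∫ x in a..b, |g x| := by
  have hab : a ≤ b := h0.1.trans h0.2
  rw [← intervalIntegral.integral_eq_sub_of_hasDerivAt (fun x _ => hf x)
    (hg.intervalIntegrable x1 x0)]
  have e1 := intervalIntegral.norm_integral_le_abs_integral_norm (f := g) (a := x1) (b := x0)
    (μ := volume)
  have e2 : |∫ x in x1..x0, ‖g x‖| ≤ |∫ x in a..b, ‖g x‖| := by
    apply intervalIntegral.abs_integral_mono_interval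
    · rw [Set.uIoc_of_le hab]
      intro t ht
      rw [Set.mem_uIoc] at ht
      rcases ht with ht | ht
      · exact ⟨lt_of_le_of_lt h1.1 ht.1, ht.2.trans h0.2⟩
      · exact ⟨lt_of_le_of_lt h0.1 ht.1, ht.2.trans h1.2⟩
    · exact Eventually.of_forall fun x => norm_nonneg _
    · exact hg.norm.intervalIntegrable _ _
  have e3 : 0 ≤ ∫ x in a..b, ‖g x‖ :=
    intervalIntegral.integral_nonneg hab (fun x _ => norm_nonneg _)
  rw [abs_of_nonneg e3] at e2
  exact (le_abs_self _).trans (e1.trans e2)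

theorem good_lines {u ux uy v vx vy : ℝ → ℝ → ℝ} (hu : C1 u ux uy) (hv : C1 v vx vy)
    {K M r ρ : ℝ} (hK : 0 < K) (hρ : 0 < ρ) (hr : ρ < r) (hM : ∀ x y, u x y ^ 2 + v x y ^ 2 ≤ M)
    (hQ : ∀ x ∈ Set.Icc (-r) r, ∀ y ∈ Set.Icc (-r) r,
      ux x y ^ 2 + uy x y ^ 2 + vx x y ^ 2 + vy x y ^ 2 ≤
        K * (ux x y * vy x y - uy x y * vx x y)) :
    ∀ᵐ y : ℝ, y ∈ Set.Ioc (-ρ) ρ → (∃ x ∈ Set.Icc (-ρ) ρ, u x y ^ 2 + v x y ^ 2 = 0) →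
      ∀ x ∈ Set.Icc (-ρ) ρ, u x y ^ 2 + v x y ^ 2 = 0 := by
  obtain ⟨C, hC⟩ := cacc hu hv hK hρ hr hM hQ
  set e : ℕ → ℝ := fun n => 1 / ((n : ℝ) + 1) with he
  have he0 : ∀ n, 0 < e n := fun n => by positivity
  have he1 : ∀ n, e n ≤ 1 := fun n => by
    simp only [he]
    rw [div_le_one (by positivity)]
    linarith [(Nat.cast_nonneg n : (0:ℝ) ≤ n)]
  set g : ℕ → ℝ → ℝ → ℝ := fun n x y => 2 * (u x y * ux x y + v x y * vx x y) /
        ((u x y ^ 2 + v x y ^ 2 + e n) * ell (M + 1) (e n) (u x y ^ 2 + v x y ^ 2)) with hg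
  have cg : ∀ n, Continuous fun z : ℝ × ℝ => g n z.1 z.2 := fun n => (hC _ (he0 n) (he1 n)).1
  set H : ℕ → ℝ → ℝ := fun n y => ∫ x in (-ρ)..ρ, |g n x y| with hH
  have cH : ∀ n, Continuous (H n) := fun n =>
    contInt (f := fun y x => |g n x y|) (cont2 (cg n) (by fun_prop) (by fun_prop)).abs _ _
  have H0 : ∀ n y, 0 ≤ H n y := fun n y =>
    intervalIntegral.integral_nonneg (by linarith) (fun x _ => abs_nonneg _)
  have hHC : ∀ n, ∫ y in (-ρ)..ρ, H n y ≤ C := by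
    intro n
    have := (hC _ (he0 n) (he1 n)).2
    rw [swapInt (f := fun x y => |g n x y|) (cg n).abs] at this
    exact this
  have hL : ∀ n, ∫⁻ y in Set.Ioc (-ρ) ρ, ENNReal.ofReal (H n y) ≤ ENNReal.ofReal C := by
    intro n
    rw [← ofReal_integral_eq_lintegral_ofReal ((cH n).integrableOn_Ioc)
      (Eventually.of_forall fun y => H0 n y)]
    apply ENNReal.ofReal_le_ofReal
    have := hHC n
    rwa [intervalIntegral.integral_of_le (by linarith)] at this
  have mf : ∀ n, Measurable fun y => ENNReal.ofReal (H n y) := fun n =>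
    (cH n).measurable.ennreal_ofReal
  have hF : ∫⁻ y in Set.Ioc (-ρ) ρ, liminf (fun n => ENNReal.ofReal (H n y)) atTop
      ≤ ENNReal.ofReal C := by
    refine (lintegral_liminf_le mf).trans ?_
    refine (liminf_le_liminf (Eventually.of_forall hL)).trans ?_
    rw [liminf_const]
  have hae := ae_lt_top (Measurable.liminf mf) (ne_top_of_le_ne_top ENNReal.ofReal_ne_top hF)
  rw [ae_restrict_iff' measurableSet_Ioc] at hae
  filter_upwards [hae] with y hy hyρ hx0 x1 hx1
  obtain ⟨x0, hx0, hz⟩ := hx0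
  by_contra hne
  have hs0 : ∀ x y, 0 ≤ u x y ^ 2 + v x y ^ 2 := fun x y => by positivity
  have hs1 : ∀ n x y, u x y ^ 2 + v x y ^ 2 + e n ≤ M + 1 := fun n x y => by
    linarith [hM x y, he1 n]
  have hl1 : ∀ n x y, 1 ≤ ell (M + 1) (e n) (u x y ^ 2 + v x y ^ 2) := fun n x y =>
    ell_ge (hs0 x y) (he0 n) (hs1 n x y)
  set s1 := u x1 y ^ 2 + v x1 y ^ 2 with hs1d
  have hs1p : 0 < s1 := lt_of_le_of_ne (hs0 x1 y) (Ne.symm hne)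
  have hlow : ∀ n, Real.log (1 + Real.log (M + 1) - Real.log (e n)) -
      Real.log (1 + Real.log (M + 1) - Real.log s1) ≤ H n y := by
    intro n
    have hd : ∀ x, HasDerivAt (fun x => Real.log (ell (M + 1) (e n) (u x y ^ 2 + v x y ^ 2)))
        (-g n x y) x := by
      intro x
      have h1 := (((ell_deriv (N := M + 1) (hs0 x y) (he0 n)).comp x ((hu.s hv).dx x y))).log
        (by have := hl1 n x y; simp only [Function.comp_apply]; positivity)
      refine h1.congr_deriv ?_
      have a1 : u x y ^ 2 + v x y ^ 2 + e n ≠ 0 := by have := hs0 x y; have := he0 n; positivity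
      have a2 : ell (M + 1) (e n) (u x y ^ 2 + v x y ^ 2) ≠ 0 := by have := hl1 n x y; positivity
      simp only [Function.comp_apply, hg]
      field_simp
    have h2 := osc_le hd (cont2 (cg n) continuous_id continuous_const).neg hx0 hx1
    simp only [abs_neg] at h2
    simp only [hz] at h2
    have h3 : ell (M + 1) (e n) 0 = 1 + Real.log (M + 1) - Real.log (e n) := by simp [ell]
    have h4 : Real.log (ell (M + 1) (e n) s1) ≤
        Real.log (1 + Real.log (M + 1) - Real.log s1) := by
      apply Real.log_le_log (by have := hl1 n x1 y; linarith)
      have := Real.log_le_log hs1p (by linarith [he0 n] : s1 ≤ s1 + e n)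
      unfold ell
      linarith
    rw [h3] at h2
    have h5 : H n y = ∫ x in (-ρ)..ρ, |g n x y| := rfl
    rw [h5]
    linarith
  have ht : Tendsto (fun n => H n y) atTop atTop := by
    refine tendsto_atTop_mono hlow ?_
    apply tendsto_atTop_add_const_right
    apply Real.tendsto_log_atTop.comp
    have : ∀ n, 1 + Real.log (M + 1) - Real.log (e n) =
        1 + Real.log (M + 1) + Real.log ((n : ℝ) + 1) := by
      intro n
      simp only [he, one_div, Real.log_inv]
      ring
    simp only [this]
    apply tendsto_atTop_add_const_left
    apply Real.tendsto_log_atTop.comp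
    exact tendsto_atTop_add_const_right _ _ tendsto_natCast_atTop_atTop
  have ht2 : Tendsto (fun n => ENNReal.ofReal (H n y)) atTop (𝓝 ⊤) :=
    ENNReal.tendsto_ofReal_atTop.comp ht
  have := hy hyρ
  rw [ht2.liminf_eq] at this
  exact lt_irrefl _ this


theorem C1.swap {p px py : ℝ → ℝ → ℝ} (hp : C1 p px py) :
    C1 (fun x y => p y x) (fun x y => py y x) (fun x y => px y x) where
  dx x y := hp.dy y x
  dy x y := hp.dx y x
  c := cont2 hp.c continuous_snd continuous_fst
  cx := cont2 hp.cy continuous_snd continuous_fst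
  cy := cont2 hp.cx continuous_snd continuous_fst

theorem dich {s : ℝ → ℝ → ℝ} {ρ : ℝ} (cs : Continuous fun z : ℝ × ℝ => s z.1 z.2)
    (hH : ∀ᵐ y : ℝ, y ∈ Set.Ioc (-ρ) ρ → (∃ x ∈ Set.Icc (-ρ) ρ, s x y = 0) →
      ∀ x ∈ Set.Icc (-ρ) ρ, s x y = 0)
    (hV : ∀ᵐ x : ℝ, x ∈ Set.Ioc (-ρ) ρ → (∃ y ∈ Set.Icc (-ρ) ρ, s x y = 0) →
      ∀ y ∈ Set.Icc (-ρ) ρ, s x y = 0) :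
    (∀ x ∈ Set.Ioo (-ρ) ρ, ∀ y ∈ Set.Ioo (-ρ) ρ, s x y = 0) ∨
    (∀ᵐ y : ℝ, y ∈ Set.Ioc (-ρ) ρ → ∀ x ∈ Set.Icc (-ρ) ρ, s x y ≠ 0) := by
  by_cases h : ∃ y ∈ Set.Ioc (-ρ) ρ, ∀ x ∈ Set.Icc (-ρ) ρ, s x y = 0
  · left
    obtain ⟨y0, hy0, h0⟩ := h
    intro x hx y hy
    by_contra hne
    have hD := Measure.dense_of_ae hV
    have hO : IsOpen (Set.Ioo (-ρ) ρ ∩ {t | s t y ≠ 0}) :=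
      isOpen_Ioo.inter (isOpen_ne_fun (cont2 cs continuous_id continuous_const) continuous_const)
    obtain ⟨t, ht, ht2⟩ := hD.exists_mem_open hO ⟨x, hx, hne⟩
    exact ht2.2 (ht ⟨ht2.1.1, ht2.1.2.le⟩ ⟨y0, ⟨hy0.1.le, hy0.2⟩, h0 t ⟨ht2.1.1.le, ht2.1.2.le⟩⟩ y
      ⟨hy.1.le, hy.2.le⟩)
  · right
    filter_upwards [hH] with y hy hyI x hx hz
    exact h ⟨y, hyI, hy hyI ⟨x, hx, hz⟩⟩

theorem side {u v u' v' : ℝ → ℝ} (hu : ∀ t, HasDerivAt u (u' t) t) (hv : ∀ t, HasDerivAt v (v' t) t)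
    (cu' : Continuous u') (cv' : Continuous v') {a b : ℝ} (hab : a ≤ b)
    (hne : ∀ t ∈ Set.Icc a b, u t ^ 2 + v t ^ 2 ≠ 0) :
    ∃ S : ℂ, Complex.exp S * (u a + v a * I) = u b + v b * I ∧
      S.im = ∫ t in a..b, (u t * v' t - v t * u' t) / (u t ^ 2 + v t ^ 2) := by
  have cu : Continuous u := continuous_iff_continuousAt.2 fun t => (hu t).continuousAt
  have cv : Continuous v := continuous_iff_continuousAt.2 fun t => (hv t).continuousAt
  set γ : ℝ → ℂ := fun t => u t + v t * I with hγ
  set γ' : ℝ → ℂ := fun t => u' t + v' t * I with hγ'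
  have cγ : Continuous γ := by fun_prop
  have cγ' : Continuous γ' := by fun_prop
  have dγ : ∀ t, HasDerivAt γ (γ' t) t := fun t =>
    (hu t).ofReal_comp.add ((hv t).ofReal_comp.mul_const I)
  have nγ : ∀ t ∈ Set.Icc a b, γ t ≠ 0 := by
    intro t ht h0
    apply hne t ht
    have h1 := congrArg Complex.re h0
    have h2 := congrArg Complex.im h0
    simp [hγ] at h1 h2
    simp [h1, h2]
  set f : ℝ → ℂ := fun t => γ' t / γ t with hf
  have cf : ContinuousOn f (Set.Icc a b) := cγ'.continuousOn.div cγ.continuousOn nγ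
  have mf : StronglyMeasurable f := (cγ'.measurable.div cγ.measurable).stronglyMeasurable
  have hI : ∀ t ∈ Set.Icc a b, IntervalIntegrable f volume a t := fun t ht =>
    (cf.mono (by rw [Set.uIcc_of_le ht.1]; exact Set.Icc_subset_Icc_right ht.2)).intervalIntegrable
  have dS : ∀ t ∈ Set.Icc a b, HasDerivAt (fun t => ∫ x in a..t, f x) (f t) t := fun t ht =>
    intervalIntegral.integral_hasDerivAt_right (hI t ht)
      (mf.stronglyMeasurableAtFilter)
      ((cγ'.continuousAt).div cγ.continuousAt (nγ t ht))
  have dφ : ∀ t ∈ Set.Icc a b,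
      HasDerivAt (fun t => γ t * Complex.exp (-∫ x in a..t, f x)) 0 t := by
    intro t ht
    refine ((dγ t).mul (dS t ht).neg.cexp).congr_deriv ?_
    have := nγ t ht
    simp only [hf, Pi.neg_apply]
    field_simp
    ring
  have hconst := constant_of_has_deriv_right_zero
    (fun t ht => (dφ t ht).continuousAt.continuousWithinAt)
    (fun t ht => (dφ t ⟨ht.1, ht.2.le⟩).hasDerivWithinAt) b ⟨hab, le_rfl⟩
  refine ⟨∫ x in a..b, f x, ?_, ?_⟩
  · simp only [intervalIntegral.integral_same, neg_zero, Complex.exp_zero, mul_one] at hconst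
    change Complex.exp _ * γ a = γ b
    rw [← hconst, mul_comm, mul_assoc, ← Complex.exp_add]
    simp
  · have h1 := Complex.imCLM.intervalIntegral_comp_comm (hI b ⟨hab, le_rfl⟩)
    simp only [Complex.imCLM_apply] at h1
    rw [← h1]
    congr 1
    ext t
    simp only [hf, hγ, hγ', Complex.div_im, Complex.normSq_apply]
    simp
    ring

theorem quant {u ux uy v vx vy : ℝ → ℝ → ℝ} (hu : C1 u ux uy) (hv : C1 v vx vy) {a b c d : ℝ}
    (hab : a ≤ b) (hcd : c ≤ d)
    (ha : ∀ y ∈ Set.Icc c d, u a y ^ 2 + v a y ^ 2 ≠ 0)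
    (hb : ∀ y ∈ Set.Icc c d, u b y ^ 2 + v b y ^ 2 ≠ 0)
    (hc : ∀ x ∈ Set.Icc a b, u x c ^ 2 + v x c ^ 2 ≠ 0)
    (hd : ∀ x ∈ Set.Icc a b, u x d ^ 2 + v x d ^ 2 ≠ 0) :
    ∃ n : ℤ, (∫ y in c..d, (u b y * vy b y - v b y * uy b y) / (u b y ^ 2 + v b y ^ 2))
    - (∫ y in c..d, (u a y * vy a y - v a y * uy a y) / (u a y ^ 2 + v a y ^ 2))
    - (∫ x in a..b, (u x d * vx x d - v x d * ux x d) / (u x d ^ 2 + v x d ^ 2))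
    + (∫ x in a..b, (u x c * vx x c - v x c * ux x c) / (u x c ^ 2 + v x c ^ 2))
    = 2 * Real.pi * n := by
  obtain ⟨Sb, eb, ib⟩ := side (hu.dy b) (hv.dy b) (hu.cyl b) (hv.cyl b) hcd hb
  obtain ⟨Sa, ea, ia⟩ := side (hu.dy a) (hv.dy a) (hu.cyl a) (hv.cyl a) hcd ha
  obtain ⟨Sd, ed, id'⟩ := side (fun x => hu.dx x d) (fun x => hv.dx x d) (hu.cxr d) (hv.cxr d) hab hd
  obtain ⟨Sc, ec, ic⟩ := side (fun x => hu.dx x c) (fun x => hv.dx x c) (hu.cxr c) (hv.cxr c) hab hc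
  rw [← ib, ← ia, ← id', ← ic]
  have h0 : (u a c : ℂ) + v a c * I ≠ 0 := by
    intro h0
    apply ha c ⟨le_rfl, hcd⟩
    have h1 := congrArg Complex.re h0
    have h2 := congrArg Complex.im h0
    simp at h1 h2
    simp [h1, h2]
  have h1 : Complex.exp (Sb + Sc) = Complex.exp (Sd + Sa) := by
    apply mul_right_cancel₀ h0
    rw [Complex.exp_add, Complex.exp_add, mul_assoc, mul_assoc, ec, ea, eb, ed]
  obtain ⟨n, hn⟩ := Complex.exp_eq_exp_iff_exists_int.1 h1
  refine ⟨n, ?_⟩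
  have h2 := congrArg Complex.im hn
  simp at h2
  linarith

theorem exF {m : ℝ} (hm : 0 < m) : ∃ F : ℝ → ℝ, (∀ s, HasDerivAt F (-1 / (max s m) ^ 2) s) ∧
    (∀ s, m ≤ s → F s = 1 / s) ∧ (∀ s, s ≤ m → F s = 2 / m - s / m ^ 2) := by
  have cf : Continuous fun s : ℝ => -1 / (max s m) ^ 2 := by
    apply Continuous.div (by fun_prop) (by fun_prop)
    intro s
    have : 0 < max s m := lt_max_of_lt_right hm
    positivity
  have key : ∀ s, HasDerivAt (fun s => 2 / m + ∫ t in (0:ℝ)..s, -1 / (max t m) ^ 2)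
      (-1 / (max s m) ^ 2) s := fun s =>
    (intervalIntegral.integral_hasDerivAt_right (cf.intervalIntegrable _ _)
      (cf.stronglyMeasurableAtFilter _ _) cf.continuousAt).const_add _
  have hlow : ∀ s, s ≤ m → 2 / m + ∫ t in (0:ℝ)..s, -1 / (max t m) ^ 2 = 2 / m - s / m ^ 2 := by
    intro s hs
    have : ∫ t in (0:ℝ)..s, -1 / (max t m) ^ 2 = ∫ t in (0:ℝ)..s, -1 / m ^ 2 := by
      apply intervalIntegral.integral_congr
      intro t ht
      rcases Set.mem_uIcc.1 ht with h | h
      · simp only [max_eq_right (h.2.trans hs)]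
      · simp only [max_eq_right (h.2.trans hm.le)]
    rw [this]
    simp
    ring
  refine ⟨_, key, ?_, hlow⟩
  intro s hs
  have h1 : ∫ t in m..s, -1 / (max t m) ^ 2 = 1 / s - 1 / m := by
    apply intervalIntegral.integral_eq_sub_of_hasDerivAt (f := fun t => 1 / t)
    · intro t ht
      rw [Set.uIcc_of_le hs] at ht
      have h0 : t ≠ 0 := by linarith [ht.1]
      rw [max_eq_left ht.1]
      simpa [one_div, neg_div] using hasDerivAt_inv h0
    · exact cf.intervalIntegrable _ _
  have h2 := hlow m le_rfl
  rw [← intervalIntegral.integral_add_adjacent_intervals (cf.intervalIntegrable 0 m)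
    (cf.intervalIntegrable m s), h1, ← add_assoc, h2]
  field_simp
  ring

theorem wind {u ux uy v vx vy : ℝ → ℝ → ℝ} (hu : C1 u ux uy) (hv : C1 v vx vy) {a b c d m : ℝ}
    (hm : 0 < m) (hab : a ≤ b) (hcd : c ≤ d)
    (ha : ∀ y ∈ Set.Icc c d, m ≤ u a y ^ 2 + v a y ^ 2)
    (hb : ∀ y ∈ Set.Icc c d, m ≤ u b y ^ 2 + v b y ^ 2)
    (hc : ∀ x ∈ Set.Icc a b, m ≤ u x c ^ 2 + v x c ^ 2)
    (hd : ∀ x ∈ Set.Icc a b, m ≤ u x d ^ 2 + v x d ^ 2) :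
    (∫ y in c..d, (u b y * vy b y - v b y * uy b y) / (u b y ^ 2 + v b y ^ 2))
    - (∫ y in c..d, (u a y * vy a y - v a y * uy a y) / (u a y ^ 2 + v a y ^ 2))
    - (∫ x in a..b, (u x d * vx x d - v x d * ux x d) / (u x d ^ 2 + v x d ^ 2))
    + (∫ x in a..b, (u x c * vx x c - v x c * ux x c) / (u x c ^ 2 + v x c ^ 2))
    = ∫ x in a..b, ∫ y in c..d, 4 * max (m - (u x y ^ 2 + v x y ^ 2)) 0 / m ^ 2 *
      (ux x y * vy x y - uy x y * vx x y) := by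
  obtain ⟨F, dF, F1, F2⟩ := exF hm
  have hone : C1 (fun _ _ => (1:ℝ)) (fun _ _ => 0) (fun _ _ => 0) :=
    ⟨fun x y => hasDerivAt_const _ _, fun x y => hasDerivAt_const _ _, continuous_const,
      continuous_const, continuous_const⟩
  have cs := (hu.s hv).c
  have key := wgreen hu hv hone (F := F) (F' := fun s => -1 / (max s m) ^ 2)
    (fun x y => dF _) (by
      apply Continuous.div (by fun_prop) ((cs.max continuous_const).pow 2)
      intro s
      have : 0 < max (u s.1 s.2 ^ 2 + v s.1 s.2 ^ 2) m := lt_max_of_lt_right hm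
      exact pow_ne_zero 2 this.ne') a b c d
  have hL : ∀ x y, 4 * max (m - (u x y ^ 2 + v x y ^ 2)) 0 / m ^ 2 *
      (ux x y * vy x y - uy x y * vx x y) =
      2 * 1 * (F (u x y ^ 2 + v x y ^ 2) +
          (u x y ^ 2 + v x y ^ 2) * (-1 / (max (u x y ^ 2 + v x y ^ 2) m) ^ 2)) *
          (ux x y * vy x y - uy x y * vx x y)
        + F (u x y ^ 2 + v x y ^ 2) * (0 * (u x y * vy x y - v x y * uy x y)
          - 0 * (u x y * vx x y - v x y * ux x y)) := by
    intro x y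
    generalize u x y ^ 2 + v x y ^ 2 = s
    rcases le_total s m with h | h
    · rw [max_eq_left (by linarith), max_eq_right h, F2 s h]
      field_simp
      ring
    · have : 0 < s := by linarith
      rw [max_eq_right (by linarith), max_eq_left h, F1 s h]
      field_simp
      ring
  simp_rw [hL]
  rw [key]
  congr 1
  · congr 1
    · congr 1
      · apply intervalIntegral.integral_congr
        intro y hy
        rw [Set.uIcc_of_le hcd] at hy
        simp only [F1 _ (hb y hy)]
        ring
      · apply intervalIntegral.integral_congr
        intro y hy
        rw [Set.uIcc_of_le hcd] at hy
        simp only [F1 _ (ha y hy)]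
        ring
    · apply intervalIntegral.integral_congr
      intro y hy
      rw [Set.uIcc_of_le hab] at hy
      simp only [F1 _ (hd y hy)]
      ring
  · apply intervalIntegral.integral_congr
    intro y hy
    rw [Set.uIcc_of_le hab] at hy
    simp only [F1 _ (hc y hy)]
    ring


theorem lineMin {f : ℝ → ℝ} (hf : Continuous f) (h0 : ∀ t, 0 ≤ f t) {ρ : ℝ}
    (hne : ∀ t ∈ Set.Icc (-ρ) ρ, f t ≠ 0) : ∃ m > 0, ∀ t ∈ Set.Icc (-ρ) ρ, m ≤ f t := by
  rcases (Set.Icc (-ρ) ρ).eq_empty_or_nonempty with h | h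
  · exact ⟨1, one_pos, by simp [h]⟩
  · obtain ⟨t, ht, hmin⟩ := isCompact_Icc.exists_isMinOn h hf.continuousOn
    exact ⟨f t, lt_of_le_of_ne (h0 t) (Ne.symm (hne t ht)), fun x hx => hmin hx⟩

theorem setDiff_zero {f : ℝ → ℝ → ℝ} (hf : Continuous fun z : ℝ × ℝ => f z.1 z.2)
    {a b c d a' b' c' d' : ℝ} (ha : a < a') (hab' : a' ≤ b') (hb : b' < b)
    (hc : c < c') (hcd' : c' ≤ d') (hd : d' < d)
    (h0 : ∀ x ∈ Set.Icc a b, ∀ y ∈ Set.Icc c d, 0 ≤ f x y)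
    (hle : ∫ x in a..b, ∫ y in c..d, f x y ≤ ∫ x in a'..b', ∫ y in c'..d', f x y) :
    ∀ z ∈ (Set.Ioo a b ×ˢ Set.Ioo c d) \ (Set.Icc a' b' ×ˢ Set.Icc c' d'), f z.1 z.2 = 0 := by
  set φ : ℝ × ℝ → ℝ := fun z => f z.1 z.2 with hφ
  have hi : ∀ a b c d : ℝ, IntegrableOn φ (Set.Ioc a b ×ˢ Set.Ioc c d) := by
    intro a b c d
    exact (hf.continuousOn.integrableOn_compact (isCompact_Icc.prod isCompact_Icc)).mono_set
      (Set.prod_mono (Set.Ioc_subset_Icc_self (a := a) (b := b))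
        (Set.Ioc_subset_Icc_self (a := c) (b := d)))
  have he : ∀ a b c d : ℝ, a ≤ b → c ≤ d →
      ∫ x in a..b, ∫ y in c..d, f x y = ∫ z in Set.Ioc a b ×ˢ Set.Ioc c d, φ z := by
    intro a b c d hab hcd
    have := setIntegral_prod (μ := volume) (ν := volume) φ (hi a b c d)
    rw [Measure.volume_eq_prod, this, intervalIntegral.integral_of_le hab]
    simp only [intervalIntegral.integral_of_le hcd, hφ]
  rw [he _ _ _ _ (by linarith) (by linarith), he _ _ _ _ hab' hcd'] at hle
  set A := Set.Ioc a b ×ˢ Set.Ioc c d with hA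
  set A' := Set.Ioc a' b' ×ˢ Set.Ioc c' d' with hA'
  have mA : MeasurableSet A := measurableSet_Ioc.prod measurableSet_Ioc
  have mA' : MeasurableSet A' := measurableSet_Ioc.prod measurableSet_Ioc
  have hsub : A' ⊆ A := Set.prod_mono (Set.Ioc_subset_Ioc ha.le hb.le)
    (Set.Ioc_subset_Ioc hc.le hd.le)
  have hdiff := setIntegral_sdiff mA' (hi a b c d) hsub
  have nn : 0 ≤ᵐ[volume.restrict (A \ A')] φ := by
    rw [EventuallyLE, ae_restrict_iff' (mA.diff mA')]
    refine Eventually.of_forall fun z hz => ?_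
    exact h0 z.1 ⟨hz.1.1.1.le, hz.1.1.2⟩ z.2 ⟨hz.1.2.1.le, hz.1.2.2⟩
  have hz : ∫ z in A \ A', φ z = 0 := by
    apply le_antisymm
    · rw [hdiff]; linarith
    · exact integral_nonneg_of_ae nn
  rw [setIntegral_eq_zero_iff_of_nonneg_ae nn ((hi a b c d).mono_set Set.sdiff_subset)] at hz
  set U := (Set.Ioo a b ×ˢ Set.Ioo c d) \ (Set.Icc a' b' ×ˢ Set.Icc c' d') with hU
  have oU : IsOpen U := (isOpen_Ioo.prod isOpen_Ioo).sdiff (isClosed_Icc.prod isClosed_Icc)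
  have hUA : U ⊆ A \ A' := by
    intro z hz
    refine ⟨⟨⟨hz.1.1.1, hz.1.1.2.le⟩, ⟨hz.1.2.1, hz.1.2.2.le⟩⟩, fun h => hz.2 ?_⟩
    exact ⟨⟨h.1.1.le, h.1.2⟩, ⟨h.2.1.le, h.2.2⟩⟩
  have hz2 : φ =ᵐ[volume.restrict U] (0 : ℝ × ℝ → ℝ) :=
    ae_restrict_of_ae_restrict_of_subset hUA hz
  have := Measure.eqOn_open_of_ae_eq hz2 oU hf.continuousOn continuousOn_const
  intro z hz
  exact this hz

theorem four_sq {p q r s : ℝ} (h : p ^ 2 + q ^ 2 + r ^ 2 + s ^ 2 ≤ 0) : q = 0 ∧ s = 0 := by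
  constructor <;> nlinarith [sq_nonneg p, sq_nonneg q, sq_nonneg r, sq_nonneg s]

set_option maxHeartbeats 4000000 in
theorem core {u ux uy v vx vy : ℝ → ℝ → ℝ} (hu : C1 u ux uy) (hv : C1 v vx vy)
    {K M r ρ : ℝ} (hK : 0 < K) (hρ : 0 < ρ) (hr : ρ < r) (hM : ∀ x y, u x y ^ 2 + v x y ^ 2 ≤ M)
    (hQ : ∀ x ∈ Set.Icc (-r) r, ∀ y ∈ Set.Icc (-r) r,
      ux x y ^ 2 + uy x y ^ 2 + vx x y ^ 2 + vy x y ^ 2 ≤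
        K * (ux x y * vy x y - uy x y * vx x y))
    (hacc : ∀ δ > 0, ∃ x y : ℝ, |x| < δ ∧ |y| < δ ∧ (x ≠ 0 ∨ y ≠ 0) ∧
      u x y ^ 2 + v x y ^ 2 = 0) :
    ∀ x ∈ Set.Ioo (-ρ) ρ, ∀ y ∈ Set.Ioo (-ρ) ρ, u x y ^ 2 + v x y ^ 2 = 0 := by
  have hs0 : ∀ x y, 0 ≤ u x y ^ 2 + v x y ^ 2 := fun x y => by positivity
  have cs := (hu.s hv).c
  have gH := good_lines hu hv hK hρ hr hM hQ
  have gV := good_lines (M := M) hv.swap hu.swap hK hρ hr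
    (fun x y => by rw [add_comm]; exact hM y x)
    (fun x hx y hy => by
      have := hQ y hy x hx
      linarith)
  have gV' : ∀ᵐ x : ℝ, x ∈ Set.Ioc (-ρ) ρ → (∃ y ∈ Set.Icc (-ρ) ρ, u x y ^ 2 + v x y ^ 2 = 0) →
      ∀ y ∈ Set.Icc (-ρ) ρ, u x y ^ 2 + v x y ^ 2 = 0 := by
    filter_upwards [gV] with x hx hxI hex y hy
    rw [add_comm]
    apply hx hxI _ y hy
    obtain ⟨t, ht, ht2⟩ := hex
    exact ⟨t, ht, by rw [add_comm]; exact ht2⟩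
  by_contra hcon
  have HH := (dich (s := fun x y => u x y ^ 2 + v x y ^ 2) cs gH gV').resolve_left hcon
  have HV := (dich (s := fun x y => u y x ^ 2 + v y x ^ 2)
    (hu.s hv).swap.c gV' gH).resolve_left
      (fun h => hcon fun x hx y hy => h y hy x hx)
  have DH := Measure.dense_of_ae HH
  have DV := Measure.dense_of_ae HV
  have J0 : ∀ x ∈ Set.Icc (-ρ) ρ, ∀ y ∈ Set.Icc (-ρ) ρ, 0 ≤ ux x y * vy x y - uy x y * vx x y := by
    intro x hx y hy
    have h1 := hQ x ⟨by linarith [hx.1], by linarith [hx.2]⟩ y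
      ⟨by linarith [hy.1], by linarith [hy.2]⟩
    have h2 : 0 ≤ K * (ux x y * vy x y - uy x y * vx x y) := le_trans (by positivity) h1
    exact nonneg_of_mul_nonneg_right h2 hK
  set W : ℝ → ℝ → ℝ → ℝ → ℝ := fun a b c d =>
    (∫ y in c..d, (u b y * vy b y - v b y * uy b y) / (u b y ^ 2 + v b y ^ 2))
    - (∫ y in c..d, (u a y * vy a y - v a y * uy a y) / (u a y ^ 2 + v a y ^ 2))
    - (∫ x in a..b, (u x d * vx x d - v x d * ux x d) / (u x d ^ 2 + v x d ^ 2))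
    + (∫ x in a..b, (u x c * vx x c - v x c * ux x c) / (u x c ^ 2 + v x c ^ 2)) with hW
  set f : ℝ → ℝ → ℝ → ℝ := fun m x y => 4 * max (m - (u x y ^ 2 + v x y ^ 2)) 0 / m ^ 2 *
      (ux x y * vy x y - uy x y * vx x y) with hf
  have cf : ∀ m, Continuous fun z : ℝ × ℝ => f m z.1 z.2 := fun m =>
    ((continuous_const.mul ((continuous_const.sub cs).max continuous_const)).div_const _).mul
      ((hu.cx.mul hv.cy).sub (hu.cy.mul hv.cx))
  have f0 : ∀ m, ∀ x ∈ Set.Icc (-ρ) ρ, ∀ y ∈ Set.Icc (-ρ) ρ, 0 ≤ f m x y := by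
    intro m x hx y hy
    have h1 : 0 ≤ max (m - (u x y ^ 2 + v x y ^ 2)) 0 := le_max_right _ _
    exact mul_nonneg (by positivity) (J0 x hx y hy)
  -- good rectangles, with lower bound for the boundary values and the winding number
  let Good : ℝ → ℝ → ℝ → ℝ → ℕ → Prop := fun a b c d n =>
    (-ρ < a ∧ a < 0 ∧ 0 < b ∧ b < ρ) ∧ (-ρ < c ∧ c < 0 ∧ 0 < d ∧ d < ρ) ∧
    (∃ m0 > 0, ∀ m, 0 < m → m ≤ m0 →
      ∫ x in a..b, ∫ y in c..d, f m x y = 2 * Real.pi * n)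
  have exGood : ∀ δ > 0, δ ≤ ρ → ∃ a b c d n, Good a b c d n ∧
      -δ < a ∧ b < δ ∧ -δ < c ∧ d < δ := by
    intro δ hδ hδρ
    obtain ⟨a, ha, ha1, ha2⟩ := DV.exists_between (by linarith : -δ < 0)
    obtain ⟨b, hb, hb1, hb2⟩ := DV.exists_between hδ
    obtain ⟨c, hc, hc1, hc2⟩ := DH.exists_between (by linarith : -δ < 0)
    obtain ⟨d, hd, hd1, hd2⟩ := DH.exists_between hδ
    have ha' := ha ⟨by linarith, by linarith⟩
    have hb' := hb ⟨by linarith, by linarith⟩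
    have hc' := hc ⟨by linarith, by linarith⟩
    have hd' := hd ⟨by linarith, by linarith⟩
    obtain ⟨ma, ma0, hma⟩ := lineMin ((hu.s hv).cl a) (fun t => hs0 a t) ha'
    obtain ⟨mb, mb0, hmb⟩ := lineMin ((hu.s hv).cl b) (fun t => hs0 b t) hb'
    obtain ⟨mc, mc0, hmc⟩ := lineMin ((hu.s hv).cr c) (fun t => hs0 t c) hc'
    obtain ⟨md, md0, hmd⟩ := lineMin ((hu.s hv).cr d) (fun t => hs0 t d) hd'
    have i1 : ∀ x ∈ Set.Icc a b, x ∈ Set.Icc (-ρ) ρ := fun x hx =>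
      ⟨by linarith [hx.1], by linarith [hx.2]⟩
    have i2 : ∀ x ∈ Set.Icc c d, x ∈ Set.Icc (-ρ) ρ := fun x hx =>
      ⟨by linarith [hx.1], by linarith [hx.2]⟩
    obtain ⟨n, hn⟩ := quant hu hv (by linarith : a ≤ b) (by linarith : c ≤ d)
      (fun y hy => ha' y (i2 y hy)) (fun y hy => hb' y (i2 y hy))
      (fun y hy => hc' y (i1 y hy)) (fun y hy => hd' y (i1 y hy))
    have hI : ∀ m, 0 < m → m ≤ min (min ma mb) (min mc md) →
        ∫ x in a..b, ∫ y in c..d, f m x y = 2 * Real.pi * n := by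
      intro m hm0 hm
      have l1 : m ≤ ma := hm.trans ((min_le_left _ _).trans (min_le_left _ _))
      have l2 : m ≤ mb := hm.trans ((min_le_left _ _).trans (min_le_right _ _))
      have l3 : m ≤ mc := hm.trans ((min_le_right _ _).trans (min_le_left _ _))
      have l4 : m ≤ md := hm.trans ((min_le_right _ _).trans (min_le_right _ _))
      rw [← hn]
      exact (wind hu hv hm0 (by linarith : a ≤ b) (by linarith : c ≤ d)
        (fun y hy => l1.trans (hma y (i2 y hy))) (fun y hy => l2.trans (hmb y (i2 y hy)))
        (fun y hy => l3.trans (hmc y (i1 y hy))) (fun y hy => l4.trans (hmd y (i1 y hy)))).symm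
    have hmp : 0 < min (min ma mb) (min mc md) := by positivity
    have hn0 : 0 ≤ n := by
      have h1 := hI _ hmp le_rfl
      have h2 : 0 ≤ ∫ x in a..b, ∫ y in c..d, f (min (min ma mb) (min mc md)) x y :=
        intervalIntegral.integral_nonneg (by linarith) fun x hx =>
          intervalIntegral.integral_nonneg (by linarith) fun y hy =>
            f0 _ x (i1 x hx) y (i2 y hy)
      rw [h1] at h2
      have h3 : (0:ℝ) ≤ n := nonneg_of_mul_nonneg_right h2 (by positivity)
      exact_mod_cast h3
    obtain ⟨k, rfl⟩ := Int.eq_ofNat_of_zero_le hn0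
    refine ⟨a, b, c, d, k, ⟨⟨by linarith, ha2, hb1, by linarith⟩, ⟨by linarith, hc2, hd1,
      by linarith⟩, _, hmp, fun m h1 h2 => ?_⟩, ha1, hb2, hc1, hd2⟩
    rw [hI m h1 h2]
    simp
  classical
  have hex : ∃ n, ∃ a b c d, Good a b c d n := by
    obtain ⟨a, b, c, d, n, h, _⟩ := exGood ρ hρ le_rfl
    exact ⟨n, a, b, c, d, h⟩
  obtain ⟨a, b, c, d, hG⟩ := Nat.find_spec hex
  have hmin : ∀ n', (∃ a b c d, Good a b c d n') → Nat.find hex ≤ n' := fun n' h =>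
    Nat.find_min' hex h
  obtain ⟨⟨ga, ga0, gb0, gb⟩, ⟨gc, gc0, gd0, gd⟩, m1, hm1, hI1⟩ := hG
  have hδ : 0 < min (min (-a) b) (min (-c) d) := by
    have : 0 < -a := by linarith
    have : 0 < -c := by linarith
    positivity
  obtain ⟨x1, y1, hx1, hy1, hne, hz⟩ := hacc _ hδ
  simp only [lt_min_iff, abs_lt] at hx1 hy1
  have hδ' : 0 < max |x1| |y1| := by
    rcases hne with h | h
    · exact lt_max_of_lt_left (abs_pos.2 h)
    · exact lt_max_of_lt_right (abs_pos.2 h)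
  have hb1 : max |x1| |y1| < min (min (-a) b) (min (-c) d) := by
    simp only [lt_min_iff, max_lt_iff, abs_lt]
    tauto
  simp only [lt_min_iff] at hb1
  obtain ⟨a', b', c', d', n', hG', ha', hb', hc', hd'⟩ := exGood _ hδ' (by linarith)
  have hnn := hmin n' ⟨a', b', c', d', hG'⟩
  obtain ⟨⟨ga', ga0', gb0', gb'⟩, ⟨gc', gc0', gd0', gd'⟩, m2, hm2, hI2⟩ := hG'
  have hm : 0 < min m1 m2 := lt_min hm1 hm2
  have E1 := hI1 _ hm (min_le_left _ _)
  have E2 := hI2 _ hm (min_le_right _ _)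
  have hle : ∫ x in a..b, ∫ y in c..d, f (min m1 m2) x y ≤
      ∫ x in a'..b', ∫ y in c'..d', f (min m1 m2) x y := by
    rw [E1, E2]
    have : ((Nat.find hex : ℕ) : ℝ) ≤ n' := by exact_mod_cast hnn
    exact mul_le_mul_of_nonneg_left this (by positivity)
  have hzero := setDiff_zero (cf (min m1 m2)) (by linarith : a < a') (by linarith : a' ≤ b')
    (by linarith : b' < b) (by linarith : c < c') (by linarith : c' ≤ d') (by linarith : d' < d)
    (fun x hx y hy => f0 _ x ⟨by linarith [hx.1], by linarith [hx.2]⟩ y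
      ⟨by linarith [hy.1], by linarith [hy.2]⟩) hle
  set U := (Set.Ioo a b ×ˢ Set.Ioo c d) \ (Set.Icc a' b' ×ˢ Set.Icc c' d') with hU
  have oU : IsOpen U := (isOpen_Ioo.prod isOpen_Ioo).sdiff (isClosed_Icc.prod isClosed_Icc)
  have oV : IsOpen (U ∩ {z : ℝ × ℝ | u z.1 z.2 ^ 2 + v z.1 z.2 ^ 2 < min m1 m2}) :=
    oU.inter (isOpen_lt cs continuous_const)
  have hzU : ((x1, y1) : ℝ × ℝ) ∈ U := by
    refine ⟨⟨⟨by linarith [hx1.1.1.1], by linarith [hx1.1.2.2]⟩,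
      ⟨by linarith [hy1.2.1.1], by linarith [hy1.2.2.2]⟩⟩, fun h => ?_⟩
    have k1 : |x1| < max |x1| |y1| := by
      rw [abs_lt]; exact ⟨by linarith [h.1.1], by linarith [h.1.2]⟩
    have k2 : |y1| < max |x1| |y1| := by
      rw [abs_lt]; exact ⟨by linarith [h.2.1], by linarith [h.2.2]⟩
    exact lt_irrefl _ (max_lt k1 k2)
  obtain ⟨e, he, hball⟩ := Metric.isOpen_iff.1 oV (x1, y1) ⟨hzU, by
    simp only [Set.mem_ofPred_eq, hz]; exact hm⟩
  obtain ⟨y2, hy2, hy21, hy22⟩ := DH.exists_between (by linarith : y1 < y1 + e)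
  have hmem : ∀ y ∈ Set.Icc y1 y2, (x1, y) ∈
      U ∩ {z : ℝ × ℝ | u z.1 z.2 ^ 2 + v z.1 z.2 ^ 2 < min m1 m2} := by
    intro y hy
    apply hball
    rw [Metric.mem_ball, Prod.dist_eq, dist_self, Real.dist_eq]
    apply max_lt he
    rw [abs_lt]
    exact ⟨by linarith [hy.1], by linarith [hy.2]⟩
  have hD0 : ∀ y ∈ Set.Icc y1 y2, uy x1 y = 0 ∧ vy x1 y = 0 := by
    intro y hy
    have h1 := hmem y hy
    have h2 := hzero _ h1.1
    have h3 : u x1 y ^ 2 + v x1 y ^ 2 < min m1 m2 := h1.2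
    simp only [hf] at h2
    have h4 : 0 < max (min m1 m2 - (u x1 y ^ 2 + v x1 y ^ 2)) 0 :=
      lt_max_of_lt_left (by linarith)
    have h5 : ux x1 y * vy x1 y - uy x1 y * vx x1 y = 0 := by
      rcases mul_eq_zero.1 h2 with h | h
      · exact absurd h (by positivity)
      · exact h
    have h1x := h1.1.1.1
    have h1y := h1.1.1.2
    simp only [Set.mem_Ioo] at h1x h1y
    have h6 := hQ x1 ⟨by linarith [h1x.1], by linarith [h1x.2]⟩ y
      ⟨by linarith [h1y.1], by linarith [h1y.2]⟩
    rw [h5, mul_zero] at h6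
    exact four_sq h6
  have ku := constant_of_has_deriv_right_zero (f := fun y => u x1 y)
    (hu.cl x1).continuousOn
    (fun t ht => by
      have := (hu.dy x1 t).hasDerivWithinAt (s := Set.Ici t)
      rwa [(hD0 t ⟨ht.1, ht.2.le⟩).1] at this) y2 ⟨hy21.le, le_rfl⟩
  have kv := constant_of_has_deriv_right_zero (f := fun y => v x1 y)
    (hv.cl x1).continuousOn
    (fun t ht => by
      have := (hv.dy x1 t).hasDerivWithinAt (s := Set.Ici t)
      rwa [(hD0 t ⟨ht.1, ht.2.le⟩).2] at this) y2 ⟨hy21.le, le_rfl⟩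
  have hfin := hmem y2 ⟨hy21.le, le_rfl⟩
  have hfx := hfin.1.1.1
  have hfy := hfin.1.1.2
  simp only [Set.mem_Ioo] at hfx hfy
  refine hy2 ⟨by linarith [hfy.1], by linarith [hfy.2]⟩ x1
    ⟨by linarith [hfx.1], by linarith [hfx.2]⟩ ?_
  rw [ku, kv]
  exact hz


theorem lineDeriv_re {U : ℂ → ℂ} (hU : ContDiff ℝ 1 U) (z₀ : ℂ) :
    C1 (fun x y => (U (z₀ + (x + y * I))).re) (fun x y => (fderiv ℝ U (z₀ + (x + y * I)) 1).re)
      (fun x y => (fderiv ℝ U (z₀ + (x + y * I)) I).re) ∧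
    C1 (fun x y => (U (z₀ + (x + y * I))).im) (fun x y => (fderiv ℝ U (z₀ + (x + y * I)) 1).im)
      (fun x y => (fderiv ℝ U (z₀ + (x + y * I)) I).im) := by
  have hd : ∀ z, HasFDerivAt U (fderiv ℝ U z) z := fun z =>
    (hU.differentiable one_ne_zero z).hasFDerivAt
  have hx : ∀ x y : ℝ, HasDerivAt (fun t : ℝ => U (z₀ + (t + y * I)))
      (fderiv ℝ U (z₀ + (x + y * I)) 1) x := by
    intro x y
    have h1 : HasDerivAt (fun t : ℝ => z₀ + ((t : ℂ) + y * I)) 1 x :=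
      ((hasDerivAt_id x).ofReal_comp.add_const _).const_add _
    exact (hd _).comp_hasDerivAt x h1
  have hy : ∀ x y : ℝ, HasDerivAt (fun t : ℝ => U (z₀ + (x + t * I)))
      (fderiv ℝ U (z₀ + (x + y * I)) I) y := by
    intro x y
    have h1 : HasDerivAt (fun t : ℝ => z₀ + ((x : ℂ) + t * I)) I y := by
      simpa using (((hasDerivAt_id y).ofReal_comp.mul_const I).const_add (x : ℂ)).const_add z₀
    exact (hd _).comp_hasDerivAt y h1
  have cz : Continuous (fun z : ℝ × ℝ => z₀ + ((z.1 : ℂ) + z.2 * I)) := by fun_prop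
  have c0 := hU.continuous.comp cz
  have cf : Continuous (fun z : ℝ × ℝ => fderiv ℝ U (z₀ + ((z.1 : ℂ) + z.2 * I))) :=
    (hU.continuous_fderiv one_ne_zero).comp cz
  have c1 := cf.clm_apply (continuous_const (y := (1 : ℂ)))
  have c2 := cf.clm_apply (continuous_const (y := I))
  refine ⟨⟨fun x y => ?_, fun x y => ?_, ?_, ?_, ?_⟩, ⟨fun x y => ?_, fun x y => ?_, ?_, ?_, ?_⟩⟩
  · exact reCLM.hasFDerivAt.comp_hasDerivAt x (hx x y)
  · exact reCLM.hasFDerivAt.comp_hasDerivAt y (hy x y)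
  · exact continuous_re.comp c0
  · exact continuous_re.comp c1
  · exact continuous_re.comp c2
  · exact imCLM.hasFDerivAt.comp_hasDerivAt x (hx x y)
  · exact imCLM.hasFDerivAt.comp_hasDerivAt y (hy x y)
  · exact continuous_im.comp c0
  · exact continuous_im.comp c1
  · exact continuous_im.comp c2

theorem qr_ineq {p q : ℂ} {a : ℝ} (ha0 : 0 ≤ a) (ha1 : a < 1)
    (h : ‖(2⁻¹ : ℝ) • (p + I • q)‖ ≤ a * ‖(2⁻¹ : ℝ) • (p - I • q)‖) :
    p.re ^ 2 + q.re ^ 2 + p.im ^ 2 + q.im ^ 2 ≤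
      4 / (1 - a ^ 2) * (p.re * q.im - q.re * p.im) := by
  have h2 : ‖p + I * q‖ ≤ a * ‖p - I * q‖ := by
    rw [norm_smul, norm_smul, smul_eq_mul] at h
    norm_num at h
    linarith
  have h3 : ‖p + I * q‖ ^ 2 ≤ a ^ 2 * ‖p - I * q‖ ^ 2 := by
    rw [← mul_pow]
    exact pow_le_pow_left₀ (norm_nonneg _) h2 2
  rw [Complex.sq_norm, Complex.sq_norm, normSq_apply, normSq_apply] at h3
  simp only [add_re, sub_re, mul_re, I_re, I_im, add_im, sub_im, mul_im] at h3
  have hp : 0 < 1 - a ^ 2 := by nlinarith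
  have ha2 : a ^ 2 < 1 := by linarith
  rw [div_mul_eq_mul_div, le_div_iff₀ hp]
  have h0 : 0 ≤ p.re * q.im - q.re * p.im := by
    nlinarith [sq_nonneg (p.re + q.im), sq_nonneg (p.im - q.re)]
  nlinarith [mul_nonneg (sq_nonneg a) h0]

theorem box_norm (x y : ℝ) : ‖(x + y * I : ℂ)‖ ≤ |x| + |y| := by
  refine (norm_add_le _ _).trans ?_
  simp

theorem local_zero {u : ℂ → ℂ} (hu : ContDiffOn ℝ 1 u (ball (0 : ℂ) 1))
    {a : ℝ} (ha0 : 0 ≤ a) (ha1 : a < 1)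
    (hineq : ∀ z ∈ ball (0 : ℂ) 1, ‖(2⁻¹ : ℝ) • (fderiv ℝ u z 1 + I • fderiv ℝ u z I)‖
      ≤ a * ‖(2⁻¹ : ℝ) • (fderiv ℝ u z 1 - I • fderiv ℝ u z I)‖)
    {z₀ : ℂ} (hz₀ : z₀ ∈ ball (0 : ℂ) 1)
    (hacc : AccPt z₀ (𝓟 {z : ℂ | z ∈ ball (0 : ℂ) 1 ∧ u z = 0})) :
    ∀ᶠ z in 𝓝 z₀, u z = 0 := by
  obtain ⟨R, hR, hRD⟩ := Metric.nhds_basis_closedBall.mem_iff.1 (isOpen_ball.mem_nhds hz₀)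
  let χ : ContDiffBump z₀ := ⟨R / 2, R, by positivity, by linarith⟩
  set U : ℂ → ℂ := fun z => χ z • u z with hUdef
  have hts : tsupport χ ⊆ ball (0 : ℂ) 1 := by
    rw [χ.tsupport_eq]; exact hRD
  have hUC : ContDiff ℝ 1 U := by
    rw [contDiff_iff_contDiffAt]
    intro z
    by_cases hz : z ∈ ball (0 : ℂ) 1
    · exact χ.contDiffAt.smul (hu.contDiffAt (isOpen_ball.mem_nhds hz))
    · have h1 : z ∉ tsupport χ := fun h => hz (hts h)
      have h2 : U =ᶠ[𝓝 z] fun _ => 0 := by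
        filter_upwards [notMem_tsupport_iff_eventuallyEq.1 h1] with w hw
        simp [hUdef, hw]
      exact contDiffAt_const.congr_of_eventuallyEq h2
  have hcs : HasCompactSupport U := χ.hasCompactSupport.smul_right
  obtain ⟨B, hB⟩ := hUC.continuous.bounded_above_of_compact_support hcs
  have heq : ∀ z ∈ ball z₀ (R / 2), U =ᶠ[𝓝 z] u := by
    intro z hz
    filter_upwards [isOpen_ball.mem_nhds hz] with w hw
    have : χ w = 1 := χ.one_of_mem_closedBall (ball_subset_closedBall hw)
    simp [hUdef, this]
  obtain ⟨hC1, hC2⟩ := lineDeriv_re hUC z₀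
  have hbox : ∀ x y : ℝ, |x| ≤ R / 5 → |y| ≤ R / 5 → z₀ + (x + y * I) ∈ ball z₀ (R / 2) := by
    intro x y hx hy
    rw [mem_ball, dist_eq_norm, add_sub_cancel_left]
    have := box_norm x y
    linarith
  have hsq : ∀ z, (U z).re ^ 2 + (U z).im ^ 2 = ‖U z‖ ^ 2 := by
    intro z; rw [Complex.sq_norm, normSq_apply]; ring
  have hsub : ball z₀ (R / 2) ⊆ ball 0 1 := fun z hz =>
    hRD (closedBall_subset_closedBall (by linarith) (ball_subset_closedBall hz))
  have hp : 0 < 1 - a ^ 2 := by nlinarith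
  have key := core hC1 hC2 (K := 4 / (1 - a ^ 2)) (M := B ^ 2) (r := R / 5) (ρ := R / 10)
    (by positivity) (by positivity) (by linarith)
    (fun x y => by
      rw [hsq]; exact pow_le_pow_left₀ (norm_nonneg _) (hB _) 2)
    (fun x hx y hy => by
      have hz := hbox x y (abs_le.2 hx) (abs_le.2 hy)
      rw [(heq _ hz).fderiv_eq]
      exact qr_ineq ha0 ha1 (hineq _ (hsub hz)))
    (fun δ hδ => by
      rw [accPt_iff_nhds] at hacc
      obtain ⟨w, ⟨hw1, hw2⟩, hw3⟩ := hacc (ball z₀ δ) (ball_mem_nhds _ hδ)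
      rw [mem_ball, dist_eq_norm] at hw1
      have e : z₀ + (((w - z₀).re : ℂ) + ((w - z₀).im : ℂ) * I) = w := by
        rw [re_add_im]; ring
      refine ⟨(w - z₀).re, (w - z₀).im, (abs_re_le_norm _).trans_lt hw1,
        (abs_im_le_norm _).trans_lt hw1, ?_, ?_⟩
      · by_contra hcon
        push Not at hcon
        exact hw3 (sub_eq_zero.1 (Complex.ext hcon.1 hcon.2))
      · rw [e, hsq]
        simp [hUdef, hw2.2])
  filter_upwards [ball_mem_nhds z₀ (show 0 < R / 10 by positivity)] with w hw
  rw [mem_ball, dist_eq_norm] at hw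
  have e : z₀ + (((w - z₀).re : ℂ) + ((w - z₀).im : ℂ) * I) = w := by
    rw [re_add_im]; ring
  have h1 := key (w - z₀).re (abs_lt.1 ((abs_re_le_norm _).trans_lt hw))
    (w - z₀).im (abs_lt.1 ((abs_im_le_norm _).trans_lt hw))
  rw [e, hsq] at h1
  have h2 : U w = 0 := by simpa using h1
  have h3 : w ∈ ball z₀ (R / 2) := by
    rw [mem_ball, dist_eq_norm]; linarith
  rw [← (heq w h3).eq_of_nhds, h2]

/-- scalar Beltrami-type uniqueness: if `u : D → ℂ` is `C¹` with
`|∂u/∂z̄| ≤ a·|∂u/∂z|` on `D` for some constant `0 ≤ a < 1`, and the zero set of `u`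
has an accumulation point in `D`, then `u ≡ 0` on `D`. -/
theorem scalar_quasiconformal_uniqueness
    (u : ℂ → ℂ) (hu : ContDiffOn ℝ 1 u (ball (0 : ℂ) 1))
    (a : ℝ) (ha0 : 0 ≤ a) (ha1 : a < 1)
    (hineq : ∀ z ∈ ball (0 : ℂ) 1, ‖dbar u z‖ ≤ a * ‖dz u z‖)
    (hacc : ∃ z₀ ∈ ball (0 : ℂ) 1,
      AccPt z₀ (𝓟 {z : ℂ | z ∈ ball (0 : ℂ) 1 ∧ u z = 0})) :
    ∀ z ∈ ball (0 : ℂ) 1, u z = 0 := by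
  obtain ⟨z₀, hz₀, hz⟩ := hacc
  have hloc : ∀ w ∈ ball (0 : ℂ) 1, AccPt w (𝓟 {z : ℂ | z ∈ ball (0 : ℂ) 1 ∧ u z = 0}) →
      w ∈ interior {z : ℂ | u z = 0} := fun w hw h =>
    mem_interior_iff_mem_nhds.2 (local_zero hu ha0 ha1 hineq hw h)
  have hsub : ball (0 : ℂ) 1 ⊆ interior {z : ℂ | u z = 0} := by
    refine (convex_ball (0 : ℂ) 1).isPreconnected.subset_of_closure_inter_subset
      isOpen_interior ⟨z₀, hz₀, hloc z₀ hz₀ hz⟩ ?_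
    rintro w ⟨hw, hwD⟩
    apply hloc w hwD
    rw [accPt_iff_nhds]
    intro N hN
    obtain ⟨O, hO1, hO2, hO3⟩ := _root_.mem_nhds_iff.1 (inter_mem hN (isOpen_ball.mem_nhds hwD))
    obtain ⟨q, hq1, hq2⟩ := mem_closure_iff.1 hw O hO2 hO3
    have hop : (O ∩ interior {z : ℂ | u z = 0}) ∈ 𝓝 q :=
      (hO2.inter isOpen_interior).mem_nhds ⟨hq1, hq2⟩
    obtain ⟨y, hy, hyw⟩ : ∃ y ∈ O ∩ interior {z : ℂ | u z = 0}, y ≠ w := by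
      by_contra hcon
      push Not at hcon
      have hs : ({w} : Set ℂ) ∈ 𝓝 q := mem_of_superset hop fun y hy => hcon y hy
      have hqw : q = w := Set.mem_singleton_iff.1 (mem_of_mem_nhds hs)
      rw [hqw] at hs
      have := (𝓝[≠] w).nonempty_of_mem (inter_mem_nhdsWithin {w}ᶜ hs)
      obtain ⟨t, ht1, ht2⟩ := this
      exact ht1 ht2
    exact ⟨y, ⟨(hO1 hy.1).1, (hO1 hy.1).2,
      (interior_subset hy.2 : y ∈ {z : ℂ | u z = 0})⟩, hyw⟩
  exact fun z hz => (interior_subset (hsub hz) : z ∈ {z : ℂ | u z = 0})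
end
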